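/- arXiv:2512.02145 — 3 statements merged into one kernel-verified Lean document; each statement's English description precedes it below -/
import Mathlib

section
/- Assume Assumption A0 and let M ∈ ℕ. Then the single-edge Helmholtz modes {φ̂_n}_{n≥1} are pairwise orthogonal with respect to the κ-weighted Sobolev inner product on K̂: for all n ≠ m in ℕ with n,m ≥ 1, (φ̂_n, φ̂_m)_{H^M_κ(K̂)} = 0. -/
open MeasureTheory Real Set
open scoped Real Classical ENNReal NNReal

noncomputable section

/-- Partial derivative in the first coordinate. -/
def pd1 (f : ℝ × ℝ → ℂ) : ℝ × ℝ → ℂ := fun x => deriv (fun t => f (t, x.2)) x.1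

/-- Partial derivative in the second coordinate. -/
def pd2 (f : ℝ × ℝ → ℂ) : ℝ × ℝ → ℂ := fun x => deriv (fun t => f (x.1, t)) x.2

/-- Mixed partial derivative `∂₁^i ∂₂^j`. -/
def pdM (i j : ℕ) (f : ℝ × ℝ → ℂ) : ℝ × ℝ → ℂ := pd1^[i] (pd2^[j] f)

/-- Multi-indices of order at most `M`. -/
def idxLe (M : ℕ) : Finset (ℕ × ℕ) :=
  (Finset.range (M + 1) ×ˢ Finset.range (M + 1)).filter fun p => p.1 + p.2 ≤ M

/-- κ-weighted Sobolev inner product of order `M` on `D`. -/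
def sobInner (κ : ℝ) (M : ℕ) (D : Set (ℝ × ℝ)) (f g : ℝ × ℝ → ℂ) : ℂ :=
  ∑ p ∈ idxLe M, ((κ : ℂ) ^ (2 * (p.1 + p.2)))⁻¹ *
    ∫ x in D, pdM p.1 p.2 f x * (starRingEnd ℂ) (pdM p.1 p.2 g x)

/-- Square of the κ-weighted Sobolev norm of order `M` on `D`. -/
def sobNormSq (κ : ℝ) (M : ℕ) (D : Set (ℝ × ℝ)) (f : ℝ × ℝ → ℂ) : ℝ :=
  ∑ p ∈ idxLe M, (κ ^ (2 * (p.1 + p.2)))⁻¹ * ∫ x in D, ‖pdM p.1 p.2 f x‖ ^ 2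

/-- κ-weighted Sobolev norm of order `M` on `D`. -/
def sobNorm (κ : ℝ) (M : ℕ) (D : Set (ℝ × ℝ)) (f : ℝ × ℝ → ℂ) : ℝ :=
  Real.sqrt (sobNormSq κ M D f)

/-- Membership in `H^M_κ(D)` (for pointwise-differentiable representatives). -/
def MemSob (M : ℕ) (D : Set (ℝ × ℝ)) (f : ℝ × ℝ → ℂ) : Prop :=
  ∀ p ∈ idxLe M, IntegrableOn (fun x => ‖pdM p.1 p.2 f x‖ ^ 2) D

/-- `ν̂_n = nπ/(κ ĥ₁)`. -/
def nuHat (κ h1 : ℝ) (n : ℕ) : ℝ := n * π / (κ * h1)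

/-- Principal complex square root of a real number. -/
def csqrt (r : ℝ) : ℂ := (r : ℂ) ^ (1 / 2 : ℂ)

/-- The single-edge Helmholtz mode `φ̂_n` on the reference rectangle. -/
def phiHat (κ h1 h2 : ℝ) (n : ℕ) : ℝ × ℝ → ℂ := fun x =>
  Complex.sin (↑(κ * nuHat κ h1 n) * (x.1 : ℂ)) *
    Complex.sin ((x.2 : ℂ) * (κ : ℂ) * csqrt (1 - nuHat κ h1 n ^ 2)) /
    Complex.sin ((h2 : ℂ) * (κ : ℂ) * csqrt (1 - nuHat κ h1 n ^ 2))

/-- The open reference rectangle `K̂ = (0,ĥ₁) × (0,ĥ₂)`. -/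
def Khat (h1 h2 : ℝ) : Set (ℝ × ℝ) := Ioo 0 h1 ×ˢ Ioo 0 h2

/-- Assumption A0: `κ²` is not a Δ-Neumann eigenvalue of the rectangle with sides `h1, h2`. -/
def A0cond (κ h1 h2 : ℝ) : Prop :=
  ∀ n m : ℕ, κ ^ 2 ≠ (n * π / h1) ^ 2 + (m * π / h2) ^ 2

/-- Distributional (weak) solution of the homogeneous Helmholtz equation on `D`. -/
def WeakHelmholtz (κ : ℝ) (D : Set (ℝ × ℝ)) (u : ℝ × ℝ → ℂ) : Prop :=
  IntegrableOn u D ∧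
  ∀ φ : ℝ × ℝ → ℂ, ContDiff ℝ (⊤ : ℕ∞) φ → HasCompactSupport φ → tsupport φ ⊆ D →
    ∫ x in D, u x * (pdM 2 0 φ x + pdM 0 2 φ x + (κ : ℂ) ^ 2 * φ x) = 0

/-- The trace of `u` on the top edge (at height `h2`). -/
def traceTop (h2 : ℝ) (u : ℝ × ℝ → ℂ) : ℝ → ℂ := fun t => u (t, h2)

/-- The class `S^{N,M}_κ(K̂, ŝ)` of Helmholtz solutions with trace supported on the top edge. -/
structure SLoc (κ h1 h2 : ℝ) (N M : ℕ) (u : ℝ × ℝ → ℂ) : Prop where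
  cont : ContinuousOn u (Icc 0 h1 ×ˢ Icc 0 h2)
  mem : MemSob 1 (Khat h1 h2) u
  helm : WeakHelmholtz κ (Khat h1 h2) u
  left : ∀ y ∈ Icc (0 : ℝ) h2, u (0, y) = 0
  right : ∀ y ∈ Icc (0 : ℝ) h2, u (h1, y) = 0
  bottom : ∀ x ∈ Icc (0 : ℝ) h1, u (x, 0) = 0
  traceReg : ContDiffOn ℝ M (traceTop h2 u) (Icc 0 h1)
  endpt0 : ∀ j < N, iteratedDerivWithin (2 * j) (traceTop h2 u) (Icc 0 h1) 0 = 0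
  endpt1 : ∀ j < N, iteratedDerivWithin (2 * j) (traceTop h2 u) (Icc 0 h1) h1 = 0

/-- Square of the trace seminorm `|u|_{H^M_κ(ŝ)}`. -/
def traceSemiSq (κ h1 h2 : ℝ) (M : ℕ) (u : ℝ × ℝ → ℂ) : ℝ :=
  (κ ^ (2 * M))⁻¹ * ∫ t in (0 : ℝ)..h1, ‖iteratedDerivWithin M (traceTop h2 u) (Icc 0 h1) t‖ ^ 2

/-- The `L²(ŝ)` inner product of traces on the top edge. -/
def traceL2Inner (h1 h2 : ℝ) (u v : ℝ × ℝ → ℂ) : ℂ :=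
  ∫ t in (0 : ℝ)..h1, u (t, h2) * (starRingEnd ℂ) (v (t, h2))

/-- The squared `L²(ŝ)` norm of the trace on the top edge. -/
def traceL2Sq (h1 h2 : ℝ) (u : ℝ × ℝ → ℂ) : ℝ :=
  ∫ t in (0 : ℝ)..h1, ‖u (t, h2)‖ ^ 2


theorem pd1_iterate_mul (i : ℕ) (X Y : ℝ → ℂ) :
    pd1^[i] (fun x => X x.1 * Y x.2) = fun x => iteratedDeriv i X x.1 * Y x.2 := by
  induction i with
  | zero => simp
  | succ k ih =>
    rw [Function.iterate_succ_apply', ih]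
    funext x
    simp only [pd1, iteratedDeriv_succ]
    exact deriv_mul_const_field _

theorem pd2_iterate_mul (j : ℕ) (X Y : ℝ → ℂ) :
    pd2^[j] (fun x => X x.1 * Y x.2) = fun x => X x.1 * iteratedDeriv j Y x.2 := by
  induction j with
  | zero => simp
  | succ k ih =>
    rw [Function.iterate_succ_apply', ih]
    funext x
    simp only [pd2, iteratedDeriv_succ]
    exact deriv_const_mul_field _

/-- Mixed partial derivatives of a function with separated variables. -/
theorem pdM_mul (i j : ℕ) (X Y : ℝ → ℂ) :
    pdM i j (fun x => X x.1 * Y x.2) =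
      fun x => iteratedDeriv i X x.1 * iteratedDeriv j Y x.2 := by
  rw [pdM, pd2_iterate_mul, pd1_iterate_mul]

theorem hasDerivAt_sin_mul (a t : ℝ) :
    HasDerivAt (fun t : ℝ => Real.sin (a * t)) (a * Real.cos (a * t)) t := by
  simpa [mul_comm] using ((hasDerivAt_id t).const_mul a).sin

theorem hasDerivAt_cos_mul (a t : ℝ) :
    HasDerivAt (fun t : ℝ => Real.cos (a * t)) (-(a * Real.sin (a * t))) t := by
  simpa [mul_comm] using ((hasDerivAt_id t).const_mul a).cos

/-- Every iterated derivative of `t ↦ sin (a t)` is a multiple of `sin (a t)` or `cos (a t)`,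
according to the parity of its order. -/
theorem exists_iteratedDeriv_sin_mul (a : ℝ) (i : ℕ) :
    ∃ c : ℂ, iteratedDeriv i (fun t : ℝ => Complex.sin (↑a * (t : ℂ))) =
      if Even i then fun t : ℝ => c * ((Real.sin (a * t) : ℝ) : ℂ)
      else fun t : ℝ => c * ((Real.cos (a * t) : ℝ) : ℂ) := by
  induction i with
  | zero => exact ⟨1, by simp⟩
  | succ k ih =>
    obtain ⟨c, hc⟩ := ih
    rw [iteratedDeriv_succ, hc]
    by_cases hk : Even k
    · refine ⟨c * a, ?_⟩
      simp only [hk, if_true, Nat.even_add_one, not_true, if_false]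
      funext t
      rw [((hasDerivAt_sin_mul a t).ofReal_comp.const_mul c).deriv]
      push_cast
      ring
    · refine ⟨-(c * a), ?_⟩
      simp only [hk, if_false, Nat.even_add_one, not_false_eq_true, if_true]
      funext t
      rw [((hasDerivAt_cos_mul a t).ofReal_comp.const_mul c).deriv]
      push_cast
      ring

theorem integral_sin_mul_sin_mul_eq_zero {a b h : ℝ} (hab : a ^ 2 ≠ b ^ 2)
    (ha : Real.sin (a * h) = 0) (hb : Real.sin (b * h) = 0) :
    ∫ t in (0 : ℝ)..h, Real.sin (a * t) * Real.sin (b * t) = 0 := by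
  have hne : a ^ 2 - b ^ 2 ≠ 0 := sub_ne_zero.mpr hab
  rw [intervalIntegral.integral_eq_sub_of_hasDerivAt (f := fun t =>
    (b * (Real.sin (a * t) * Real.cos (b * t)) - a * (Real.cos (a * t) * Real.sin (b * t)))
      / (a ^ 2 - b ^ 2))]
  · simp [ha, hb]
  · intro t _
    refine HasDerivAt.congr_deriv
      (((((hasDerivAt_sin_mul a t).mul (hasDerivAt_cos_mul b t)).const_mul b).sub
        (((hasDerivAt_cos_mul a t).mul (hasDerivAt_sin_mul b t)).const_mul a)).div_const _) ?_
    field_simp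
    ring
  · exact Continuous.intervalIntegrable (by fun_prop) _ _

theorem integral_cos_mul_cos_mul_eq_zero {a b h : ℝ} (hab : a ^ 2 ≠ b ^ 2)
    (ha : Real.sin (a * h) = 0) (hb : Real.sin (b * h) = 0) :
    ∫ t in (0 : ℝ)..h, Real.cos (a * t) * Real.cos (b * t) = 0 := by
  have hne : a ^ 2 - b ^ 2 ≠ 0 := sub_ne_zero.mpr hab
  rw [intervalIntegral.integral_eq_sub_of_hasDerivAt (f := fun t =>
    (a * (Real.sin (a * t) * Real.cos (b * t)) - b * (Real.cos (a * t) * Real.sin (b * t)))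
      / (a ^ 2 - b ^ 2))]
  · simp [ha, hb]
  · intro t _
    refine HasDerivAt.congr_deriv
      (((((hasDerivAt_sin_mul a t).mul (hasDerivAt_cos_mul b t)).const_mul a).sub
        (((hasDerivAt_cos_mul a t).mul (hasDerivAt_sin_mul b t)).const_mul b)).div_const _) ?_
    field_simp
    ring
  · exact Continuous.intervalIntegrable (by fun_prop) _ _

/-- Derivatives of equal order of two Dirichlet sine modes on `(0, h)` are orthogonal. -/
theorem integral_iteratedDeriv_sin_mul_eq_zero {a b h : ℝ} (hh : 0 ≤ h) (hab : a ^ 2 ≠ b ^ 2)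
    (ha : Real.sin (a * h) = 0) (hb : Real.sin (b * h) = 0) (i : ℕ) :
    ∫ t in Ioo 0 h, iteratedDeriv i (fun t : ℝ => Complex.sin (↑a * (t : ℂ))) t *
      (starRingEnd ℂ) (iteratedDeriv i (fun t : ℝ => Complex.sin (↑b * (t : ℂ))) t) = 0 := by
  obtain ⟨c, hc⟩ := exists_iteratedDeriv_sin_mul a i
  obtain ⟨d, hd⟩ := exists_iteratedDeriv_sin_mul b i
  rw [← integral_Ioc_eq_integral_Ioo, ← intervalIntegral.integral_of_le hh, hc, hd]
  have key (f g : ℝ → ℝ) (hfg : ∫ t in (0 : ℝ)..h, f t * g t = 0) :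
      ∫ t in (0 : ℝ)..h, c * (f t : ℂ) * (starRingEnd ℂ) (d * (g t : ℂ)) = 0 := by
    have hcongr (t : ℝ) : c * (f t : ℂ) * (starRingEnd ℂ) (d * (g t : ℂ)) =
        c * (starRingEnd ℂ) d * ((f t * g t : ℝ) : ℂ) := by
      rw [map_mul, Complex.conj_ofReal]
      push_cast
      ring
    simp_rw [hcongr]
    rw [intervalIntegral.integral_const_mul, intervalIntegral.integral_ofReal, hfg]
    simp
  split_ifs
  · exact key _ _ (integral_sin_mul_sin_mul_eq_zero hab ha hb)
  · exact key _ _ (integral_cos_mul_cos_mul_eq_zero hab ha hb)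

/-- Lemma 2.4, orthogonality: under Assumption A0 the single-edge Helmholtz
modes are pairwise orthogonal in `H^M_κ(K̂)`. -/
theorem edge_modes_orthogonal (κ h1 h2 : ℝ) (hκ : 0 < κ) (hh1 : 0 < h1) (hh2 : 0 < h2)
    (hA0 : A0cond κ h1 h2) (M : ℕ) :
    ∀ n m : ℕ, 1 ≤ n → 1 ≤ m → n ≠ m →
      sobInner κ M (Khat h1 h2) (phiHat κ h1 h2 n) (phiHat κ h1 h2 m) = 0 := by
  intro n m _ _ hnm
  have hfreq (k : ℕ) : κ * nuHat κ h1 k * h1 = k * π := by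
    unfold nuHat
    field_simp
  have hsin (k : ℕ) : Real.sin (κ * nuHat κ h1 k * h1) = 0 := by
    rw [hfreq, Real.sin_nat_mul_pi]
  have hsq : (κ * nuHat κ h1 n) ^ 2 ≠ (κ * nuHat κ h1 m) ^ 2 := by
    intro h
    have h' : (n * π) ^ 2 = (m * π) ^ 2 := by
      rw [← hfreq, ← hfreq, mul_pow, h, ← mul_pow]
    have h'' := (sq_eq_sq₀ (by positivity) (by positivity)).mp h'
    exact hnm (Nat.cast_injective (mul_right_cancel₀ Real.pi_ne_zero h''))
  have hpd (k : ℕ) : ∃ Y : ℝ → ℂ, ∀ i j, pdM i j (phiHat κ h1 h2 k) = fun x =>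
      iteratedDeriv i (fun t : ℝ => Complex.sin (↑(κ * nuHat κ h1 k) * (t : ℂ))) x.1 *
        iteratedDeriv j Y x.2 := by
    refine ⟨fun t => Complex.sin ((t : ℂ) * (κ : ℂ) * csqrt (1 - nuHat κ h1 k ^ 2)) /
      Complex.sin ((h2 : ℂ) * (κ : ℂ) * csqrt (1 - nuHat κ h1 k ^ 2)), fun i j => ?_⟩
    rw [← pdM_mul]
    congr 1
    funext x
    exact mul_div_assoc _ _ _
  obtain ⟨Y, hY⟩ := hpd n
  obtain ⟨Z, hZ⟩ := hpd m
  refine Finset.sum_eq_zero fun p _ => ?_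
  have hprod := setIntegral_prod_mul (μ := (volume : Measure ℝ)) (ν := (volume : Measure ℝ))
    (fun t => iteratedDeriv p.1 (fun t : ℝ => Complex.sin (↑(κ * nuHat κ h1 n) * (t : ℂ))) t *
      (starRingEnd ℂ)
        (iteratedDeriv p.1 (fun t : ℝ => Complex.sin (↑(κ * nuHat κ h1 m) * (t : ℂ))) t))
    (fun t => iteratedDeriv p.2 Y t * (starRingEnd ℂ) (iteratedDeriv p.2 Z t))
    (Ioo 0 h1) (Ioo 0 h2)
  rw [integral_iteratedDeriv_sin_mul_eq_zero hh1.le hsq (hsin n) (hsin m), zero_mul] at hprod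
  refine mul_eq_zero_of_right _ (Eq.trans (integral_congr_ae (.of_forall fun x => ?_)) hprod)
  simp only [hY, hZ, map_mul]
  exact mul_mul_mul_comm _ _ _ _

end
end

section
/- Assume Assumption A0 and let M ∈ ℕ. Define d̂ := inf{ |√(1−ν̂_n²) − mπ/(κĥ₂)| : m ∈ ℕ, n ≥ 1 with ν̂_n < 1 }. Then d̂ > 0, and for every n ≥ 1 with ν̂_n < 1 one has ‖φ̂_n‖²_{H^M_κ(K̂)} ≤ ĥ₁π²(M+1)² / (8κ²ĥ₂d̂²). -/
open MeasureTheory Real Set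
open scoped Real Classical ENNReal NNReal

noncomputable section

/-- `d̂`: the distance (in `ℝ≥0∞`, so that the infimum over an empty family is `∞`)
from `κ` to the resonances associated with propagative modes. -/
def dHat (κ h1 h2 : ℝ) : ℝ≥0∞ :=
  ⨅ (n : ℕ) (_ : 1 ≤ n) (_ : nuHat κ h1 n < 1) (m : ℕ),
    ENNReal.ofReal |Real.sqrt (1 - nuHat κ h1 n ^ 2) - m * π / (κ * h2)|

/-- Iterated second partial derivatives of a product of shifted sines. -/
lemma pd2_iterate_sin_mul_sin (c a b p : ℝ) (j : ℕ) :
    pd2^[j] (fun x => ((c * sin (a * x.1 + p) * sin (b * x.2) : ℝ) : ℂ)) =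
      fun x => ((c * b ^ j * sin (a * x.1 + p) * sin (b * x.2 + j * (π / 2)) : ℝ) : ℂ) := by
  induction j with
  | zero => simp
  | succ j ih =>
    rw [Function.iterate_succ_apply', ih]
    funext x
    have h : HasDerivAt (fun t : ℝ => b * t + j * (π / 2)) b x.2 := by
      simpa using ((hasDerivAt_id x.2).const_mul b).add_const (j * (π / 2))
    have h' := (h.sin.const_mul (c * b ^ j * sin (a * x.1 + p))).ofReal_comp
    refine h'.deriv.trans ?_
    have e : sin (b * x.2 + ((j + 1 : ℕ) : ℝ) * (π / 2)) = cos (b * x.2 + j * (π / 2)) := by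
      rw [← sin_add_pi_div_two]
      push_cast
      ring_nf
    rw [e]
    congr 1
    ring

/-- Iterated first partial derivatives of a product of shifted sines. -/
lemma pd1_iterate_sin_mul_sin (c a b q : ℝ) (i : ℕ) :
    pd1^[i] (fun x => ((c * sin (a * x.1) * sin (b * x.2 + q) : ℝ) : ℂ)) =
      fun x => ((c * a ^ i * sin (a * x.1 + i * (π / 2)) * sin (b * x.2 + q) : ℝ) : ℂ) := by
  induction i with
  | zero => simp
  | succ i ih =>
    rw [Function.iterate_succ_apply', ih]
    funext x
    have h : HasDerivAt (fun t : ℝ => a * t + i * (π / 2)) a x.1 := by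
      simpa using ((hasDerivAt_id x.1).const_mul a).add_const (i * (π / 2))
    have h' := ((h.sin.const_mul (c * a ^ i)).mul_const (sin (b * x.2 + q))).ofReal_comp
    refine h'.deriv.trans ?_
    have e : sin (a * x.1 + ((i + 1 : ℕ) : ℝ) * (π / 2)) = cos (a * x.1 + i * (π / 2)) := by
      rw [← sin_add_pi_div_two]
      push_cast
      ring_nf
    rw [e]
    congr 1
    ring

/-- Mixed partial derivatives of a product of sines. -/
lemma pdM_sin_mul_sin (c a b : ℝ) (i j : ℕ) :
    pdM i j (fun x => ((c * sin (a * x.1) * sin (b * x.2) : ℝ) : ℂ)) =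
      fun x => ((c * b ^ j * a ^ i * sin (a * x.1 + i * (π / 2)) *
        sin (b * x.2 + j * (π / 2)) : ℝ) : ℂ) := by
  have h := pd2_iterate_sin_mul_sin c a b 0 j
  simp only [add_zero] at h
  rw [pdM, h, pd1_iterate_sin_mul_sin]

lemma csqrt_of_nonneg {r : ℝ} (hr : 0 ≤ r) : csqrt r = (Real.sqrt r : ℂ) := by
  rw [csqrt, Real.sqrt_eq_rpow, Complex.ofReal_cpow hr]
  norm_num

/-- A propagative mode is a real multiple of a product of sines. -/
lemma phiHat_eq_of_propagative {κ h1 h2 : ℝ} {n : ℕ} (h : 0 ≤ 1 - nuHat κ h1 n ^ 2) :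
    phiHat κ h1 h2 n = fun x =>
      (((sin (h2 * κ * √(1 - nuHat κ h1 n ^ 2)))⁻¹ * sin (κ * nuHat κ h1 n * x.1) *
        sin (κ * √(1 - nuHat κ h1 n ^ 2) * x.2) : ℝ) : ℂ) := by
  funext x
  rw [phiHat, csqrt_of_nonneg h]
  push_cast
  rw [show (κ : ℂ) * √(1 - nuHat κ h1 n ^ 2) * x.2 = x.2 * κ * √(1 - nuHat κ h1 n ^ 2) by ring]
  ring

lemma setIntegral_sin_sq_of_mul_eq_nat_mul_pi {a h : ℝ} (ha : a ≠ 0) (hh : 0 ≤ h) {n : ℕ}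
    (hn : a * h = n * π) (p : ℝ) : ∫ t in Ioo 0 h, sin (a * t + p) ^ 2 = h / 2 := by
  rw [← integral_Ioc_eq_integral_Ioo, ← intervalIntegral.integral_of_le hh,
    intervalIntegral.integral_comp_mul_add (fun t => sin t ^ 2) ha, integral_sin_sq, hn,
    add_comm (n * π) p, sin_add_nat_mul_pi, cos_add_nat_mul_pi]
  have e : ((-1 : ℝ) ^ n) * ((-1 : ℝ) ^ n) = 1 := by
    rw [← mul_pow]; norm_num
  rw [show (-1 : ℝ) ^ n * sin p * ((-1) ^ n * cos p) =
    ((-1 : ℝ) ^ n * (-1) ^ n) * (sin p * cos p) by ring, e]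
  simp only [mul_zero, zero_add, smul_eq_mul]
  have : (n : ℝ) * π = a * h := hn.symm
  rw [this]
  field_simp
  ring

lemma setIntegral_sin_sq_le {h : ℝ} (hh : 0 ≤ h) (b q : ℝ) :
    ∫ t in Ioo 0 h, sin (b * t + q) ^ 2 ≤ h := by
  have key := norm_setIntegral_le_of_norm_le_const (μ := volume) (s := Ioo 0 h)
    (f := fun t => sin (b * t + q) ^ 2) (C := 1) (by simp) fun t _ => by
      rw [norm_of_nonneg (sq_nonneg _)]
      exact sin_sq_le_one _
  refine (le_abs_self _).trans (key.trans ?_)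
  simp [hh]

/-- The distance of `t` to the nearest natural multiple of `π` is controlled by `|sin t|`. -/
lemma exists_nat_abs_sub_mul_pi_le {t : ℝ} (ht : 0 ≤ t) :
    ∃ m : ℕ, |t - m * π| ≤ π / 2 * |sin t| := by
  have h0 : 0 ≤ round (t / π) := by
    rw [round_eq]
    exact Int.floor_nonneg.2 (by positivity)
  obtain ⟨m, hm⟩ := Int.eq_ofNat_of_zero_le h0
  refine ⟨m, ?_⟩
  have h1 := abs_sub_round (t / π)
  rw [hm, Int.cast_natCast] at h1
  have h2 : |t - m * π| ≤ π / 2 := by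
    have : t - m * π = (t / π - m) * π := by field_simp
    rw [this, abs_mul, abs_of_pos pi_pos]
    nlinarith [pi_pos]
  have h3 := mul_abs_le_abs_sin h2
  have h4 : |sin (t - m * π)| = |sin t| := by
    rw [sin_sub_nat_mul_pi, abs_mul]
    simp
  rw [h4] at h3
  calc |t - m * π| = π / 2 * (2 / π * |t - m * π|) := by field_simp
    _ ≤ _ := by gcongr

lemma nuHat_nonneg {κ h1 : ℝ} (hκ : 0 < κ) (hh1 : 0 < h1) (n : ℕ) : 0 ≤ nuHat κ h1 n := by
  unfold nuHat
  positivity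

/-- Sobolev norm bound for a propagative mode in terms of the sine in its denominator. -/
lemma sobNormSq_phiHat_le {κ h1 h2 : ℝ} (hκ : 0 < κ) (hh1 : 0 < h1) (hh2 : 0 < h2) (M : ℕ)
    {n : ℕ} (hn : 1 ≤ n) (hν : nuHat κ h1 n < 1) :
    sobNormSq κ M (Khat h1 h2) (phiHat κ h1 h2 n) ≤
      (M + 1) ^ 2 * (((sin (h2 * κ * √(1 - nuHat κ h1 n ^ 2)))⁻¹) ^ 2 * (h1 / 2 * h2)) := by
  have hν0 := nuHat_nonneg hκ hh1 n
  have hs : 0 ≤ 1 - nuHat κ h1 n ^ 2 := by nlinarith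
  have ha : κ * nuHat κ h1 n * h1 = n * π := by
    unfold nuHat; field_simp
  have ha0 : κ * nuHat κ h1 n ≠ 0 := by
    intro h
    rw [h, zero_mul] at ha
    have : (0 : ℝ) < n * π := mul_pos (by exact_mod_cast hn) pi_pos
    linarith
  have hs0 := Real.sqrt_nonneg (1 - nuHat κ h1 n ^ 2)
  have hs1 : √(1 - nuHat κ h1 n ^ 2) ≤ 1 := Real.sqrt_le_one.2 (by nlinarith)
  rw [phiHat_eq_of_propagative hs]
  generalize √(1 - nuHat κ h1 n ^ 2) = s at *
  generalize nuHat κ h1 n = ν at *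
  generalize (sin (h2 * κ * s))⁻¹ = c
  rw [sobNormSq]
  refine (Finset.sum_le_card_nsmul _ _ (c ^ 2 * (h1 / 2 * h2)) ?_).trans ?_
  · rintro ⟨i, j⟩ -
    rw [pdM_sin_mul_sin]
    have e : ∀ x : ℝ × ℝ, ‖((c * (κ * s) ^ j * (κ * ν) ^ i * sin (κ * ν * x.1 + i * (π / 2)) *
        sin (κ * s * x.2 + j * (π / 2)) : ℝ) : ℂ)‖ ^ 2 =
        (c * (κ * s) ^ j * (κ * ν) ^ i) ^ 2 * (sin (κ * ν * x.1 + i * (π / 2)) ^ 2 *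
          sin (κ * s * x.2 + j * (π / 2)) ^ 2) := fun x => by
      rw [Complex.norm_real, Real.norm_eq_abs, sq_abs]
      ring
    simp only [e]
    rw [integral_const_mul, Khat, Measure.volume_eq_prod,
      setIntegral_prod_mul (fun x => sin (κ * ν * x + i * (π / 2)) ^ 2)
        (fun y => sin (κ * s * y + j * (π / 2)) ^ 2),
      setIntegral_sin_sq_of_mul_eq_nat_mul_pi ha0 hh1.le ha]
    have hI := setIntegral_sin_sq_le hh2.le (κ * s) (j * (π / 2))
    have hw : (ν ^ i * s ^ j) ^ 2 ≤ 1 :=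
      pow_le_one₀ (by positivity)
        (mul_le_one₀ (pow_le_one₀ hν0 hν.le) (by positivity) (pow_le_one₀ hs0 hs1))
    calc _ = (ν ^ i * s ^ j) ^ 2 *
          (c ^ 2 * (h1 / 2 * ∫ y in Ioo 0 h2, sin (κ * s * y + j * (π / 2)) ^ 2)) := by
          field_simp
          ring
      _ ≤ 1 * (c ^ 2 * (h1 / 2 * h2)) := by
          gcongr
      _ = _ := one_mul _
  · rw [nsmul_eq_mul]
    gcongr
    have : (idxLe M).card ≤ (M + 1) ^ 2 := by
      refine (Finset.card_filter_le _ _).trans ?_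
      simp [sq]
    exact_mod_cast this

/-- Assumption A0 keeps the resonance distance positive. -/
lemma dHat_pos {κ h1 h2 : ℝ} (hκ : 0 < κ) (hh1 : 0 < h1) (hh2 : 0 < h2)
    (hA0 : A0cond κ h1 h2) : 0 < dHat κ h1 h2 := by
  let z : ℕ → ℝ := fun n => √(1 - nuHat κ h1 n ^ 2) * (κ * h2 / π)
  let δ : ℕ → ℝ≥0∞ := fun n =>
    if nuHat κ h1 n < 1 then ENNReal.ofReal (|z n - round (z n)| * (π / (κ * h2))) else 1
  obtain ⟨N, hN⟩ := exists_nat_gt (κ * h1 / π)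
  have hpos : 0 < (Finset.range N).inf δ := by
    rw [Finset.lt_inf_iff (by simp)]
    intro n _
    simp only [δ]
    split_ifs with hν
    · rw [ENNReal.ofReal_pos]
      refine mul_pos (abs_pos.2 (sub_ne_zero.2 fun h => ?_)) (by positivity)
      have hν0 := nuHat_nonneg hκ hh1 n
      have hs : 0 ≤ 1 - nuHat κ h1 n ^ 2 := by nlinarith
      refine hA0 n (round (z n)).natAbs ?_
      have hsq : (((round (z n)).natAbs : ℕ) : ℝ) ^ 2 = z n ^ 2 := by
        rw [Nat.cast_natAbs, Int.cast_abs, sq_abs, ← h]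
      have e1 : (n * π / h1) ^ 2 = κ ^ 2 * nuHat κ h1 n ^ 2 := by
        unfold nuHat; field_simp
      have e2 : ((((round (z n)).natAbs : ℕ) : ℝ) * π / h2) ^ 2 =
          κ ^ 2 * (1 - nuHat κ h1 n ^ 2) := by
        rw [div_pow, mul_pow, hsq]
        simp only [z]
        rw [mul_pow, Real.sq_sqrt hs]
        field_simp
      rw [e1, e2]
      ring
    · exact one_pos
  refine hpos.trans_le ?_
  refine le_iInf fun n => le_iInf fun _ => le_iInf fun hν => le_iInf fun m => ?_
  have hnN : n ∈ Finset.range N := by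
    rw [Finset.mem_range]
    have h1 : (n : ℝ) < κ * h1 / π := by
      rw [nuHat, div_lt_one (by positivity)] at hν
      rwa [lt_div_iff₀ pi_pos]
    exact_mod_cast h1.trans hN
  refine (Finset.inf_le hnN).trans ?_
  simp only [δ, if_pos hν]
  refine ENNReal.ofReal_le_ofReal ?_
  have h := round_le (z n) (m : ℤ)
  rw [Int.cast_natCast] at h
  calc _ ≤ |z n - m| * (π / (κ * h2)) := by gcongr
    _ = |(z n - m) * (π / (κ * h2))| := by
      rw [abs_mul, abs_of_pos (a := π / (κ * h2)) (by positivity)]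
    _ = _ := by
      congr 1
      simp only [z]
      field_simp

/-- Lemma 2.4, propagative bound: under Assumption A0, `d̂ > 0` and the
`H^M_κ(K̂)` norm of each propagative mode satisfies
`‖φ̂_n‖² ≤ ĥ₁π²(M+1)²/(8κ²ĥ₂d̂²)`. -/
theorem propagative_mode_bound (κ h1 h2 : ℝ) (hκ : 0 < κ) (hh1 : 0 < h1) (hh2 : 0 < h2)
    (hA0 : A0cond κ h1 h2) (M : ℕ) :
    0 < dHat κ h1 h2 ∧
    ∀ n : ℕ, 1 ≤ n → nuHat κ h1 n < 1 →
      ENNReal.ofReal (sobNormSq κ M (Khat h1 h2) (phiHat κ h1 h2 n)) * (dHat κ h1 h2) ^ 2 ≤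
        ENNReal.ofReal (h1 * π ^ 2 * (M + 1) ^ 2 / (8 * κ ^ 2 * h2)) := by
  refine ⟨dHat_pos hκ hh1 hh2 hA0, fun n hn hν => ?_⟩
  have hB := sobNormSq_phiHat_le hκ hh1 hh2 M hn hν
  set s := √(1 - nuHat κ h1 n ^ 2) with hs
  have hs0 : 0 ≤ s := Real.sqrt_nonneg _
  obtain ⟨m, hm⟩ := exists_nat_abs_sub_mul_pi_le (t := h2 * κ * s) (by positivity)
  have hd : dHat κ h1 h2 ≤ ENNReal.ofReal |s - m * π / (κ * h2)| :=
    iInf_le_of_le n (iInf_le_of_le hn (iInf_le_of_le hν (iInf_le _ m)))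
  have hr : |s - m * π / (κ * h2)| ≤ π / (2 * κ * h2) * |sin (h2 * κ * s)| := by
    have e : s - m * π / (κ * h2) = (h2 * κ * s - m * π) / (κ * h2) := by field_simp
    rw [e, abs_div, abs_of_pos (a := κ * h2) (by positivity), div_le_iff₀ (by positivity)]
    refine hm.trans (le_of_eq ?_)
    field_simp
  generalize sin (h2 * κ * s) = S at *
  have hS : (S⁻¹) ^ 2 * |S| ^ 2 ≤ 1 := by
    rw [sq_abs, ← mul_pow]
    by_cases h : S = 0 <;> simp [h]
  calc _ ≤ ENNReal.ofReal ((M + 1) ^ 2 * ((S⁻¹) ^ 2 * (h1 / 2 * h2))) *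
        ENNReal.ofReal (π / (2 * κ * h2) * |S|) ^ 2 := by
        gcongr
        exact hd.trans (ENNReal.ofReal_le_ofReal hr)
    _ = ENNReal.ofReal (h1 * π ^ 2 * (M + 1) ^ 2 / (8 * κ ^ 2 * h2) * ((S⁻¹) ^ 2 * |S| ^ 2)) := by
        rw [← ENNReal.ofReal_pow (by positivity), ← ENNReal.ofReal_mul (by positivity)]
        congr 1
        generalize S⁻¹ = T
        field_simp
        ring
    _ ≤ _ := ENNReal.ofReal_le_ofReal (mul_le_of_le_one_right (by positivity) hS)

end
end

section
/- Assume Assumption A0. Let N, M ≥ 1 be integers with N ≤ ⌈M/2⌉, and let μ ∈ ℕ with μ ≤ min(2N, M). Let u ∈ H¹(K̂) be a weak solution of −Δu − κ²u = 0 in K̂ whose trace vanishes on ∂K̂ ∖ ŝ, whose trace on ŝ lies in H^M(ŝ), and such that the tangential derivatives ∂₁^{2j}(u|_ŝ) vanish at both endpoints of ŝ for all 0 ≤ j ≤ N−1. Then u belongs to the closure of span{φ̂_n : n ≥ 1} with respect to the H^μ_κ(K̂) norm, and its expansion coefficients are determined by its trace on ŝ: for every n ≥ 1, (u, φ̂_n)_{H^μ_κ(K̂)}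 / ‖φ̂_n‖_{H^μ_κ(K̂)} = (‖φ̂_n‖_{H^μ_κ(K̂)} / ‖φ̂_n‖²_{L²(ŝ)}) · (u, φ̂_n)_{L²(ŝ)}. -/
open MeasureTheory Real Set
open scoped Real Classical ENNReal NNReal

noncomputable section

/-- Real-valued smooth functions with compact support in `(0,h)`. -/
structure IsTestFun (h : ℝ) (η : ℝ → ℝ) : Prop where
  smooth : ContDiff ℝ (⊤ : ℕ∞) η
  compact : HasCompactSupport η
  supp : tsupport η ⊆ Ioo 0 h

namespace IsTestFun

variable {h : ℝ} {η ζ : ℝ → ℝ}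

lemma deriv (hη : IsTestFun h η) : IsTestFun h (deriv η) where
  smooth := (contDiff_infty_iff_deriv.1 hη.smooth).2
  compact := hη.compact.deriv
  supp := (tsupport_deriv_subset (𝕜 := ℝ)).trans hη.supp

lemma sub (hη : IsTestFun h η) (hζ : IsTestFun h ζ) : IsTestFun h (fun x => η x - ζ x) where
  smooth := hη.smooth.sub hζ.smooth
  compact := hη.compact.sub hζ.compact
  supp := (tsupport_sub η ζ).trans (union_subset hη.supp hζ.supp)

lemma const_mul (c : ℝ) (hη : IsTestFun h η) : IsTestFun h (fun x => c * η x) where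
  smooth := contDiff_const.mul hη.smooth
  compact := hη.compact.mul_left
  supp := (tsupport_mul_subset_right (f := fun _ => c)).trans hη.supp

lemma eq_zero_of_notMem (hη : IsTestFun h η) {x : ℝ} (hx : x ∉ Ioo 0 h) : η x = 0 :=
  image_eq_zero_of_notMem_tsupport fun h' => hx (hη.supp h')

lemma hasDerivAt (hη : IsTestFun h η) (x : ℝ) : HasDerivAt η (_root_.deriv η x) x :=
  (hη.smooth.differentiable (by simp) x).hasDerivAt

lemma integral_eq {E : Type*} [NormedAddCommGroup E] [NormedSpace ℝ E]
    (hη : IsTestFun h η) (f : ℝ → E) :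
    ∫ x in (0 : ℝ)..h, η x • f x = ∫ x, η x • f x := by
  apply intervalIntegral.integral_eq_integral_of_support_subset
  intro x hx
  by_contra hx'
  exact hx (by simp [hη.eq_zero_of_notMem fun h' => hx' ⟨h'.1, h'.2.le⟩])

lemma exists_primitive (hη : IsTestFun h η) (hh : 0 < h) (h0 : ∫ x in (0 : ℝ)..h, η x = 0) :
    ∃ ζ, IsTestFun h ζ ∧ _root_.deriv ζ = η := by
  obtain ⟨a, b, ha, hb, hab⟩ : ∃ a b, 0 < a ∧ b < h ∧ tsupport η ⊆ Icc a b := by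
    rcases (tsupport η).eq_empty_or_nonempty with he | hne
    · exact ⟨h, 0, hh, hh, by simp [he]⟩
    · obtain ⟨a, ha⟩ := hη.compact.isCompact.exists_isLeast hne
      obtain ⟨b, hb⟩ := hη.compact.isCompact.exists_isGreatest hne
      exact ⟨a, b, (hη.supp ha.1).1, (hη.supp hb.1).2, fun x hx => ⟨ha.2 hx, hb.2 hx⟩⟩
  have hc : Continuous η := hη.smooth.continuous
  have hd : ∀ x, HasDerivAt (fun x => ∫ t in (0 : ℝ)..x, η t) (η x) x := fun x =>
    intervalIntegral.integral_hasDerivAt_right (hc.intervalIntegrable _ _)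
      (hc.stronglyMeasurableAtFilter _ _) hc.continuousAt
  have hd' : _root_.deriv (fun x => ∫ t in (0 : ℝ)..x, η t) = η := funext fun x => (hd x).deriv
  have hz : ∀ x, x ∉ Icc a b → η x = 0 := fun x hx =>
    image_eq_zero_of_notMem_tsupport fun h' => hx (hab h')
  have hsupp : tsupport (fun x => ∫ t in (0 : ℝ)..x, η t) ⊆ Icc a b := by
    apply closure_minimal _ isClosed_Icc
    intro x hx
    by_contra hx'
    apply hx
    rcases lt_or_ge x a with hxa | hxa
    · beta_reduce
      rw [intervalIntegral.integral_congr (g := fun _ => (0 : ℝ))]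
      · simp
      · intro t ht
        apply hz
        intro ht'
        rcases le_total 0 x with h1 | h1
        · rw [uIcc_of_le h1] at ht; linarith [ht.2, ht'.1]
        · rw [uIcc_of_ge h1] at ht; linarith [ht.2, ht'.1]
    · have hxb : b < x := by by_contra hxb; exact hx' ⟨hxa, not_lt.1 hxb⟩
      have := intervalIntegral.integral_add_adjacent_intervals
        (hc.intervalIntegrable (μ := volume) 0 x) (hc.intervalIntegrable x h)
      rw [h0, intervalIntegral.integral_congr (a := x) (g := fun _ => (0 : ℝ))] at this
      · simpa using this
      · intro t ht
        apply hz
        intro ht'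
        rcases le_total x h with h1 | h1
        · rw [uIcc_of_le h1] at ht; linarith [ht.1, ht'.2]
        · rw [uIcc_of_ge h1] at ht; linarith [ht.1, ht'.2]
  refine ⟨_, ⟨?_, ?_, hsupp.trans fun x hx => ⟨ha.trans_le hx.1, hx.2.trans_lt hb⟩⟩, hd'⟩
  · rw [contDiff_infty_iff_deriv]
    exact ⟨fun x => (hd x).differentiableAt, by rw [hd']; exact hη.smooth⟩
  · exact HasCompactSupport.of_support_subset_isCompact isCompact_Icc
      (subset_closure.trans hsupp)

lemma exists_integral_eq_one (hh : 0 < h) : ∃ ρ, IsTestFun h ρ ∧ ∫ x in (0 : ℝ)..h, ρ x = 1 := by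
  let b : ContDiffBump (h / 2) := ⟨h / 8, h / 4, by positivity, by linarith⟩
  have hb : IsTestFun h (b.normed volume) :=
    ⟨b.contDiff_normed, b.hasCompactSupport_normed, by
      rw [b.tsupport_normed_eq, Real.closedBall_eq_Icc]
      intro x hx
      have h1 : b.rOut = h / 4 := rfl
      rw [h1] at hx
      exact ⟨by linarith [hx.1], by linarith [hx.2]⟩⟩
  refine ⟨_, hb, ?_⟩
  have := hb.integral_eq (fun _ => (1 : ℝ))
  simp only [smul_eq_mul, mul_one] at this
  rw [this, b.integral_normed]

end IsTestFun

lemma eqOn_zero_of_forall_test {h : ℝ} (hh : 0 < h) {f : ℝ → ℂ} (hf : Continuous f)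
    (H : ∀ η, IsTestFun h η → ∫ x in (0 : ℝ)..h, (η x : ℂ) * f x = 0) :
    ∀ x ∈ Icc 0 h, f x = 0 := by
  have h1 : ∀ᵐ x : ℝ, x ∈ Ioo 0 h → f x = 0 := by
    apply isOpen_Ioo.ae_eq_zero_of_integral_contDiff_smul_eq_zero
      (hf.locallyIntegrable.locallyIntegrableOn _)
    intro η h1 h2 h3
    have h4 : IsTestFun h η := ⟨h1, h2, h3⟩
    rw [← h4.integral_eq]
    simpa using H η h4
  have h2 : EqOn f 0 (Ioo 0 h) := by
    apply Measure.eqOn_open_of_ae_eq (μ := volume) _ isOpen_Ioo hf.continuousOn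
      continuousOn_const
    rw [Filter.EventuallyEq, ae_restrict_iff' measurableSet_Ioo]
    exact h1
  have h3 := h2.closure hf continuous_zero
  rw [closure_Ioo hh.ne] at h3
  exact h3

lemma eqOn_const_of_weak_deriv {h : ℝ} (hh : 0 < h) {f : ℝ → ℂ} (hf : Continuous f)
    (H : ∀ η, IsTestFun h η → ∫ x in (0 : ℝ)..h, ((deriv η x : ℝ) : ℂ) * f x = 0) :
    ∃ c, ∀ x ∈ Icc 0 h, f x = c := by
  obtain ⟨ρ, hρ, hρ1⟩ := IsTestFun.exists_integral_eq_one hh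
  refine ⟨∫ x in (0 : ℝ)..h, (ρ x : ℂ) * f x, fun x hx => ?_⟩
  rw [← sub_eq_zero]
  refine eqOn_zero_of_forall_test hh (f := fun x => f x - _) (hf.sub continuous_const) ?_ x hx
  intro φ hφ
  have cρ := Complex.continuous_ofReal.comp hρ.smooth.continuous
  have cφ := Complex.continuous_ofReal.comp hφ.smooth.continuous
  have iρ := (hρ.smooth.continuous.intervalIntegrable (μ := volume) 0 h)
  have iφ := (hφ.smooth.continuous.intervalIntegrable (μ := volume) 0 h)
  have iρf : IntervalIntegrable (fun x => ((ρ x : ℝ) : ℂ) * f x) volume 0 h :=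
    ((cρ.mul hf).intervalIntegrable (μ := volume) 0 h)
  have iφf : IntervalIntegrable (fun x => ((φ x : ℝ) : ℂ) * f x) volume 0 h :=
    ((cφ.mul hf).intervalIntegrable (μ := volume) 0 h)
  simp only [Function.comp_def] at cρ cφ
  set I := ∫ x in (0 : ℝ)..h, φ x with hI
  obtain ⟨ζ, hζ, hζ'⟩ := (hφ.sub (hρ.const_mul I)).exists_primitive hh (by
    rw [intervalIntegral.integral_sub iφ (iρ.const_mul I),
      intervalIntegral.integral_const_mul, hρ1, mul_one, hI, sub_self])
  have h1 := H ζ hζ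
  have e1 : ∀ x, ((deriv ζ x : ℝ) : ℂ) * f x = (φ x : ℂ) * f x - I * ((ρ x : ℂ) * f x) := fun x => by
    rw [hζ']; push_cast; ring
  simp only [e1] at h1
  rw [intervalIntegral.integral_sub iφf (iρf.const_mul _),
    intervalIntegral.integral_const_mul] at h1
  simp only [mul_sub]
  rw [intervalIntegral.integral_sub iφf ((cφ.fun_mul continuous_const).intervalIntegrable _ _),
    intervalIntegral.integral_mul_const, intervalIntegral.integral_ofReal]
  exact h1

lemma integral_deriv_test_mul {h : ℝ} {η : ℝ → ℝ} (hη : IsTestFun h η) {V V' : ℝ → ℂ}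
    (hV : ∀ x, HasDerivAt V (V' x) x) (hV' : Continuous V') :
    ∫ x in (0 : ℝ)..h, ((deriv η x : ℝ) : ℂ) * V x = - ∫ x in (0 : ℝ)..h, (η x : ℂ) * V' x := by
  have hd : ∀ x, HasDerivAt (fun x => (η x : ℂ)) ((deriv η x : ℝ) : ℂ) x := fun x =>
    (hη.hasDerivAt x).ofReal_comp
  have cη := Complex.continuous_ofReal.comp hη.deriv.smooth.continuous
  have := intervalIntegral.integral_mul_deriv_eq_deriv_mul (a := 0) (b := h)
    (fun x _ => hd x) (fun x _ => hV x) (cη.intervalIntegrable _ _)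
    (hV'.intervalIntegrable _ _)
  rw [hη.eq_zero_of_notMem (x := h) (by simp), hη.eq_zero_of_notMem (x := 0) (by simp)] at this
  rw [this]; simp

lemma exists_affine_of_weak_deriv2 {h : ℝ} (hh : 0 < h) {f : ℝ → ℂ} (hf : Continuous f)
    (H : ∀ η, IsTestFun h η → ∫ x in (0 : ℝ)..h, ((deriv (deriv η) x : ℝ) : ℂ) * f x = 0) :
    ∃ c d : ℂ, ∀ x ∈ Icc 0 h, f x = c + d * x := by
  obtain ⟨ρ, hρ, hρ1⟩ := IsTestFun.exists_integral_eq_one hh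
  set d : ℂ := -∫ x in (0 : ℝ)..h, ((deriv ρ x : ℝ) : ℂ) * f x with hd
  have hlin : ∀ x : ℝ, HasDerivAt (fun x : ℝ => d * (x : ℂ)) d x := fun x => by
    simpa using (HasDerivAt.ofReal_comp (hasDerivAt_id x)).const_mul d
  have clin : Continuous (fun x : ℝ => d * (x : ℂ)) := by fun_prop
  obtain ⟨c, hc⟩ := eqOn_const_of_weak_deriv hh (f := fun x => f x - d * x)
    (hf.sub clin) (by
    intro φ hφ
    have cρ := Complex.continuous_ofReal.comp hρ.deriv.smooth.continuous
    have cφ := Complex.continuous_ofReal.comp hφ.deriv.smooth.continuous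
    have iρ := (hρ.smooth.continuous.intervalIntegrable (μ := volume) 0 h)
    have iφ := (hφ.smooth.continuous.intervalIntegrable (μ := volume) 0 h)
    have iρf : IntervalIntegrable (fun x => ((deriv ρ x : ℝ) : ℂ) * f x) volume 0 h :=
      ((cρ.mul hf).intervalIntegrable (μ := volume) 0 h)
    have iφf : IntervalIntegrable (fun x => ((deriv φ x : ℝ) : ℂ) * f x) volume 0 h :=
      ((cφ.mul hf).intervalIntegrable (μ := volume) 0 h)
    have iφl : IntervalIntegrable (fun x => ((deriv φ x : ℝ) : ℂ) * (d * (x : ℂ))) volume 0 h :=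
      ((cφ.mul clin).intervalIntegrable (μ := volume) 0 h)
    simp only [Function.comp_def] at cρ cφ
    set I := ∫ x in (0 : ℝ)..h, φ x with hI
    obtain ⟨ζ, hζ, hζ'⟩ := (hφ.sub (hρ.const_mul I)).exists_primitive hh (by
      rw [intervalIntegral.integral_sub iφ (iρ.const_mul I),
        intervalIntegral.integral_const_mul, hρ1, mul_one, hI, sub_self])
    have h1 := H ζ hζ
    have e1 : ∀ x, ((deriv (deriv ζ) x : ℝ) : ℂ) * f x
        = ((deriv φ x : ℝ) : ℂ) * f x - I * (((deriv ρ x : ℝ) : ℂ) * f x) := fun x => by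
        have := ((hφ.hasDerivAt x).fun_sub ((hρ.hasDerivAt x).const_mul I)).deriv
        rw [hζ', this]; push_cast; ring
    simp only [e1] at h1
    rw [intervalIntegral.integral_sub iφf (iρf.const_mul _),
      intervalIntegral.integral_const_mul] at h1
    simp only [mul_sub]
    rw [intervalIntegral.integral_sub iφf iφl,
      integral_deriv_test_mul hφ hlin continuous_const, intervalIntegral.integral_mul_const,
      intervalIntegral.integral_ofReal, hd]
    linear_combination h1)
  exact ⟨c, d, fun x hx => by linear_combination hc x hx⟩

lemma hasDerivAt_primitive {F : ℝ → ℂ} (hF : Continuous F) (x : ℝ) :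
    HasDerivAt (fun x => ∫ t in (0 : ℝ)..x, F t) (F x) x :=
  intervalIntegral.integral_hasDerivAt_right (hF.intervalIntegrable _ _)
    (hF.stronglyMeasurableAtFilter _ _) hF.continuousAt

/-- A continuous distributional solution of `f'' = -F` with `F` continuous is classical. -/
lemma exists_classical_of_weak {h : ℝ} (hh : 0 < h) {f F : ℝ → ℂ} (hf : Continuous f)
    (hF : Continuous F)
    (H : ∀ η, IsTestFun h η →
      ∫ x in (0 : ℝ)..h, (((deriv (deriv η) x : ℝ) : ℂ) * f x + (η x : ℂ) * F x) = 0) :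
    ∃ V V' : ℝ → ℂ, (∀ x, HasDerivAt V (V' x) x) ∧ (∀ x, HasDerivAt V' (-F x) x) ∧
      ∀ x ∈ Icc 0 h, f x = V x := by
  have d1 : ∀ x, HasDerivAt (fun x => ∫ t in (0 : ℝ)..x, F t) (F x) x := hasDerivAt_primitive hF
  have c1 : Continuous (fun x => ∫ t in (0 : ℝ)..x, F t) :=
    continuous_iff_continuousAt.2 fun x => (d1 x).continuousAt
  have d2 := hasDerivAt_primitive c1
  set G := fun x => ∫ t in (0 : ℝ)..x, F t with hG
  set W := fun x => ∫ t in (0 : ℝ)..x, G t with hW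
  have c2 : Continuous W := continuous_iff_continuousAt.2 fun x => (d2 x).continuousAt
  obtain ⟨c, d, hcd⟩ := exists_affine_of_weak_deriv2 hh (hf.add c2) (by
    intro η hη
    have i1 : IntervalIntegrable (fun x => ((deriv (deriv η) x : ℝ) : ℂ) * f x) volume 0 h :=
      ((Complex.continuous_ofReal.comp hη.deriv.deriv.smooth.continuous).mul hf).intervalIntegrable
        _ _
    have i2 : IntervalIntegrable (fun x => (η x : ℂ) * F x) volume 0 h :=
      ((Complex.continuous_ofReal.comp hη.smooth.continuous).mul hF).intervalIntegrable _ _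
    have i3 : IntervalIntegrable (fun x => ((deriv (deriv η) x : ℝ) : ℂ) * W x) volume 0 h :=
      ((Complex.continuous_ofReal.comp hη.deriv.deriv.smooth.continuous).mul c2).intervalIntegrable
        _ _
    have h1 := H η hη
    rw [intervalIntegral.integral_add i1 i2] at h1
    simp only [Pi.add_apply, mul_add]
    rw [intervalIntegral.integral_add i1 i3, integral_deriv_test_mul hη.deriv d2 c1,
      integral_deriv_test_mul hη d1 hF]
    linear_combination h1)
  refine ⟨fun x => c + d * x - W x, fun x => d - G x, fun x => ?_, fun x => ?_, fun x hx => ?_⟩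
  · have : HasDerivAt (fun x : ℝ => d * (x : ℂ)) d x := by
      simpa using (HasDerivAt.ofReal_comp (hasDerivAt_id x)).const_mul d
    exact (this.const_add c).sub (d2 x)
  · exact (d1 x).const_sub d
  · have := hcd x hx
    simp only [Pi.add_apply] at this
    linear_combination this

lemma pdM_mul_s5 (i j : ℕ) (f g : ℝ → ℂ) :
    pdM i j (fun p => f p.1 * g p.2) = fun p => (deriv^[i] f) p.1 * (deriv^[j] g) p.2 := by
  have h2 : pd2^[j] (fun p => f p.1 * g p.2) = fun p => f p.1 * (deriv^[j] g) p.2 := by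
    induction j with
    | zero => rfl
    | succ j ih =>
      rw [Function.iterate_succ_apply', ih, Function.iterate_succ_apply']
      funext p
      simp [pd2]
  unfold pdM
  rw [h2]
  induction i with
  | zero => rfl
  | succ i ih =>
    rw [Function.iterate_succ_apply', ih, Function.iterate_succ_apply']
    funext p
    simp [pd1]

lemma continuous_uncurry_integral {G : ℝ × ℝ → ℂ} (hG : Continuous G) (a b : ℝ) :
    Continuous fun x => ∫ y in a..b, G (x, y) :=
  intervalIntegral.continuous_parametric_intervalIntegral_of_continuous' (f := fun x y => G (x, y))
    hG a b

lemma continuous_uncurry_integral' {G : ℝ × ℝ → ℂ} (hG : Continuous G) (a b : ℝ) :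
    Continuous fun y => ∫ x in a..b, G (x, y) :=
  intervalIntegral.continuous_parametric_intervalIntegral_of_continuous' (f := fun y x => G (x, y))
    (hG.comp continuous_swap) a b

lemma integrableOn_Khat {E : Type*} [NormedAddCommGroup E] {h1 h2 : ℝ} {G : ℝ × ℝ → E}
    (hG : ContinuousOn G (Icc 0 h1 ×ˢ Icc 0 h2)) : IntegrableOn G (Khat h1 h2) :=
  (hG.integrableOn_compact (isCompact_Icc.prod isCompact_Icc)).mono_set
    (prod_mono Ioo_subset_Icc_self Ioo_subset_Icc_self)

lemma integral_Khat {E : Type*} [NormedAddCommGroup E] [NormedSpace ℝ E] {h1 h2 : ℝ}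
    (hh1 : 0 ≤ h1) (hh2 : 0 ≤ h2) {G : ℝ × ℝ → E}
    (hG : Continuous G) :
    ∫ x in Khat h1 h2, G x = ∫ x in (0 : ℝ)..h1, ∫ y in (0 : ℝ)..h2, G (x, y) := by
  have hi := integrableOn_Khat (h1 := h1) (h2 := h2) hG.continuousOn
  unfold Khat at *
  rw [Measure.volume_eq_prod] at *
  rw [setIntegral_prod _ hi, intervalIntegral.integral_of_le hh1, integral_Ioc_eq_integral_Ioo]
  simp only [intervalIntegral.integral_of_le hh2, integral_Ioc_eq_integral_Ioo]

lemma integral_swap_of_continuous {E : Type*} [NormedAddCommGroup E] [NormedSpace ℝ E] {h1 h2 : ℝ}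
    (hh1 : 0 ≤ h1) (hh2 : 0 ≤ h2) {G : ℝ × ℝ → E}
    (hG : Continuous G) :
    ∫ x in (0 : ℝ)..h1, ∫ y in (0 : ℝ)..h2, G (x, y)
      = ∫ y in (0 : ℝ)..h2, ∫ x in (0 : ℝ)..h1, G (x, y) := by
  have hi := (integrableOn_Khat (h1 := h1) (h2 := h2) hG.continuousOn)
  unfold Khat IntegrableOn at hi
  rw [Measure.volume_eq_prod, ← Measure.prod_restrict] at hi
  simp only [intervalIntegral.integral_of_le hh2, intervalIntegral.integral_of_le hh1,
    integral_Ioc_eq_integral_Ioo]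
  exact integral_integral_swap hi

/-- Testing a weak Helmholtz solution against a product of univariate test functions. -/
lemma WeakHelmholtz.tensor {κ h1 h2 : ℝ} (hh1 : 0 ≤ h1) (hh2 : 0 ≤ h2) {U : ℝ × ℝ → ℂ}
    (hU : Continuous U) (hw : WeakHelmholtz κ (Khat h1 h2) U) {η ψ : ℝ → ℝ}
    (hη : IsTestFun h1 η) (hψ : IsTestFun h2 ψ) :
    ∫ x in (0 : ℝ)..h1, (((deriv (deriv η) x : ℝ) : ℂ) * (∫ y in (0 : ℝ)..h2, U (x, y) * ψ y) +
      (η x : ℂ) * ∫ y in (0 : ℝ)..h2,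
        U (x, y) * (((deriv (deriv ψ) y : ℝ) : ℂ) + (κ : ℂ) ^ 2 * ψ y)) = 0 := by
  have der : ∀ {h : ℝ} {ζ : ℝ → ℝ}, IsTestFun h ζ →
      deriv (fun x => (ζ x : ℂ)) = fun x => ((deriv ζ x : ℝ) : ℂ) := fun hζ =>
    funext fun x => (hζ.hasDerivAt x).ofReal_comp.deriv
  have cη := hη.smooth.continuous
  have cψ := hψ.smooth.continuous
  have cη2 : ContDiff ℝ (1 + 1) η := contDiff_infty.1 hη.smooth 2
  have cψ2 : ContDiff ℝ (1 + 1) ψ := contDiff_infty.1 hψ.smooth 2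
  have hsub : tsupport (fun p : ℝ × ℝ => (η p.1 : ℂ) * (ψ p.2 : ℂ)) ⊆
      tsupport η ×ˢ tsupport ψ := by
    apply closure_minimal _ ((isClosed_tsupport _).prod (isClosed_tsupport _))
    intro p hp
    simp only [Function.mem_support, ne_eq, mul_eq_zero, Complex.ofReal_eq_zero, not_or] at hp
    exact ⟨subset_closure hp.1, subset_closure hp.2⟩
  have key := hw.2 (fun p => (η p.1 : ℂ) * (ψ p.2 : ℂ)) ?_ ?_ ?_
  · rw [pdM_mul_s5 2 0 (fun x => (η x : ℂ)) (fun x => (ψ x : ℂ)),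
      pdM_mul_s5 0 2 (fun x => (η x : ℂ)) (fun x => (ψ x : ℂ))] at key
    simp only [Function.iterate_succ, Function.iterate_zero, Function.comp_apply, id_eq,
      der hη, der hψ, der hη.deriv, der hψ.deriv] at key
    rw [integral_Khat hh1 hh2 (by fun_prop)] at key
    rw [← key]
    congr 1
    funext x
    rw [← intervalIntegral.integral_const_mul, ← intervalIntegral.integral_const_mul,
      ← intervalIntegral.integral_add]
    · congr 1; funext y; ring
    · exact Continuous.intervalIntegrable (by fun_prop) _ _
    · exact Continuous.intervalIntegrable (by fun_prop) _ _
  · exact (Complex.ofRealCLM.contDiff.comp (hη.smooth.comp contDiff_fst)).mul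
      (Complex.ofRealCLM.contDiff.comp (hψ.smooth.comp contDiff_snd))
  · exact HasCompactSupport.of_support_subset_isCompact (hη.compact.isCompact.prod
      hψ.compact.isCompact) (subset_closure.trans hsub)
  · exact hsub.trans (prod_mono hη.supp hψ.supp)

/-- Angular frequency `nπ/h` of the `n`-th sine mode on `(0,h)`. -/
def sineFreq (h : ℝ) (n : ℕ) : ℝ := n * π / h

lemma sin_sineFreq_mul {h : ℝ} (hh : 0 < h) (n : ℕ) : sin (sineFreq h n * h) = 0 := by
  rw [sineFreq, div_mul_cancel₀ _ hh.ne', sin_nat_mul_pi]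

/-- Sine coefficients in the first variable of a continuous weak solution solve an ODE weakly. -/
lemma WeakHelmholtz.sine_coeff {κ h1 h2 : ℝ} (hh1 : 0 < h1) (hh2 : 0 < h2) {U : ℝ × ℝ → ℂ}
    (hU : Continuous U) (hw : WeakHelmholtz κ (Khat h1 h2) U)
    (hl : ∀ y ∈ Icc 0 h2, U (0, y) = 0) (hr : ∀ y ∈ Icc 0 h2, U (h1, y) = 0) (n : ℕ)
    {ψ : ℝ → ℝ} (hψ : IsTestFun h2 ψ) :
    ∫ y in (0 : ℝ)..h2, (((deriv (deriv ψ) y : ℝ) : ℂ) *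
        (∫ x in (0 : ℝ)..h1, U (x, y) * (sin (sineFreq h1 n * x) : ℝ)) +
      (ψ y : ℂ) * (((κ : ℂ) ^ 2 - (sineFreq h1 n : ℂ) ^ 2) *
        ∫ x in (0 : ℝ)..h1, U (x, y) * (sin (sineFreq h1 n * x) : ℝ))) = 0 := by
  set ω := sineFreq h1 n with hω
  have cψ := hψ.smooth.continuous
  have cψ2 : ContDiff ℝ (1 + 1) ψ := contDiff_infty.1 hψ.smooth 2
  have cw : Continuous fun x => ∫ y in (0 : ℝ)..h2, U (x, y) * ψ y :=
    continuous_uncurry_integral (G := fun p => U p * ψ p.2) (by fun_prop) _ _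
  have cW : Continuous fun x => ∫ y in (0 : ℝ)..h2,
        U (x, y) * (((deriv (deriv ψ) y : ℝ) : ℂ) + (κ : ℂ) ^ 2 * ψ y) :=
    continuous_uncurry_integral
      (G := fun p => U p * (((deriv (deriv ψ) p.2 : ℝ) : ℂ) + (κ : ℂ) ^ 2 * ψ p.2))
      (by fun_prop) _ _
  obtain ⟨V, V', hV, hV', hVeq⟩ := exists_classical_of_weak hh1 cw cW
    (fun η hη => hw.tensor hh1.le hh2.le hU hη hψ)
  have z1 : V 0 = 0 := by
    rw [← hVeq 0 ⟨le_rfl, hh1.le⟩, intervalIntegral.integral_congr (g := fun _ => (0 : ℂ))]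
    · simp
    · intro y hy
      rw [uIcc_of_le hh2.le] at hy
      simp [hl y hy]
  have z2 : V h1 = 0 := by
    rw [← hVeq h1 ⟨hh1.le, le_rfl⟩, intervalIntegral.integral_congr (g := fun _ => (0 : ℂ))]
    · simp
    · intro y hy
      rw [uIcc_of_le hh2.le] at hy
      simp [hr y hy]
  have ds : ∀ x : ℝ, HasDerivAt (fun x : ℝ => ((sin (ω * x) : ℝ) : ℂ))
      ((ω * cos (ω * x) : ℝ) : ℂ) x := fun x => by
    have h1 : HasDerivAt (fun x : ℝ => ω * x) ω x := by simpa using (hasDerivAt_id x).const_mul ω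
    have := h1.sin.ofReal_comp
    convert! this using 2; ring
  have dc : ∀ x : ℝ, HasDerivAt (fun x : ℝ => ((ω * cos (ω * x) : ℝ) : ℂ))
      ((-ω ^ 2 * sin (ω * x) : ℝ) : ℂ) x := fun x => by
    have h1 : HasDerivAt (fun x : ℝ => ω * x) ω x := by simpa using (hasDerivAt_id x).const_mul ω
    have := (h1.cos.const_mul ω).ofReal_comp
    convert! this using 2; ring
  have dT := fun x => ((hV x).mul (dc x)).sub ((hV' x).mul (ds x))
  have cV : Continuous V := continuous_iff_continuousAt.2 fun x => (hV x).continuousAt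
  have cV' : Continuous V' := continuous_iff_continuousAt.2 fun x => (hV' x).continuousAt
  have FT := intervalIntegral.integral_eq_sub_of_hasDerivAt (a := 0) (b := h1)
    (fun x _ => dT x) (Continuous.intervalIntegrable (by fun_prop) _ _)
  simp only [Pi.sub_apply, Pi.mul_apply, z1, z2, hω, sin_sineFreq_mul hh1] at FT
  simp only [mul_zero, sin_zero, Complex.ofReal_zero, zero_mul, sub_zero] at FT
  have e : ∀ x ∈ uIcc 0 h1, V' x * ((ω * cos (ω * x) : ℝ) : ℂ) + V x * ((-ω ^ 2 * sin (ω * x) : ℝ) : ℂ) -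
      (-(∫ y in (0 : ℝ)..h2, U (x, y) * (((deriv (deriv ψ) y : ℝ) : ℂ) + (κ : ℂ) ^ 2 * ψ y)) *
        ((sin (ω * x) : ℝ) : ℂ) + V' x * ((ω * cos (ω * x) : ℝ) : ℂ)) =
      ∫ y in (0 : ℝ)..h2, U (x, y) * ((sin (ω * x) : ℝ) : ℂ) * (((deriv (deriv ψ) y : ℝ) : ℂ) +
        ((κ : ℂ) ^ 2 - (ω : ℂ) ^ 2) * ψ y) := by
    intro x hx
    rw [uIcc_of_le hh1.le] at hx
    rw [← hVeq x hx]
    have : ∀ y, U (x, y) * ((sin (ω * x) : ℝ) : ℂ) * (((deriv (deriv ψ) y : ℝ) : ℂ) +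
        ((κ : ℂ) ^ 2 - (ω : ℂ) ^ 2) * ψ y) =
      ((sin (ω * x) : ℝ) : ℂ) * (U (x, y) * (((deriv (deriv ψ) y : ℝ) : ℂ) + (κ : ℂ) ^ 2 * ψ y))
      + ((-ω ^ 2 * sin (ω * x) : ℝ) : ℂ) * (U (x, y) * ψ y) := fun y => by push_cast; ring
    simp only [this]
    rw [intervalIntegral.integral_add, intervalIntegral.integral_const_mul,
      intervalIntegral.integral_const_mul]
    · ring
    · exact Continuous.intervalIntegrable (by fun_prop) _ _
    · exact Continuous.intervalIntegrable (by fun_prop) _ _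
  rw [intervalIntegral.integral_congr e, integral_swap_of_continuous hh1.le hh2.le
    (G := fun p => U p * ((sin (ω * p.1) : ℝ) : ℂ) * (((deriv (deriv ψ) p.2 : ℝ) : ℂ) +
        ((κ : ℂ) ^ 2 - (ω : ℂ) ^ 2) * ψ p.2)) (by fun_prop)] at FT
  rw [← FT]
  congr 1
  funext y
  dsimp only
  rw [intervalIntegral.integral_mul_const]
  ring

/-- A solution of `c'' = -z² c` on `[0,h]` with `c 0 = 0` is a multiple of `sin (z y)`. -/
lemma eq_sin_of_ode {h : ℝ} (hh : 0 < h) {z : ℂ} (hz : Complex.sin (z * h) ≠ 0)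
    {c V V' : ℝ → ℂ} (hV : ∀ x, HasDerivAt V (V' x) x)
    (hV' : ∀ x, HasDerivAt V' (-(z ^ 2 * c x)) x) (hc : ∀ x ∈ Icc 0 h, c x = V x)
    (h0 : c 0 = 0) :
    ∀ y ∈ Icc 0 h, c y = c h * (Complex.sin (z * y) / Complex.sin (z * h)) := by
  have hz0 : z ≠ 0 := by rintro rfl; simp at hz
  have dl : ∀ x : ℝ, HasDerivAt (fun x : ℝ => z * (x : ℂ)) z x := fun x => by
    simpa using (HasDerivAt.ofReal_comp (hasDerivAt_id x)).const_mul z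
  have ds : ∀ x : ℝ, HasDerivAt (fun x : ℝ => Complex.sin (z * x)) (Complex.cos (z * x) * z) x :=
    fun x => (Complex.hasDerivAt_sin _).comp x (dl x)
  have dc : ∀ x : ℝ, HasDerivAt (fun x : ℝ => Complex.cos (z * x)) (-Complex.sin (z * x) * z) x :=
    fun x => (Complex.hasDerivAt_cos _).comp x (dl x)
  have const : ∀ T T' : ℝ → ℂ, (∀ x, HasDerivAt T (T' x) x) → (∀ x ∈ Ico 0 h, T' x = 0) →
      ∀ x ∈ Icc 0 h, T x = T 0 := fun T T' h1 h2 =>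
    constant_of_has_deriv_right_zero (fun x _ => (h1 x).continuousAt.continuousWithinAt)
      fun x hx => by have := (h1 x).hasDerivWithinAt (s := Ici x); rwa [h2 x hx] at this
  have k1 := const _ _ (fun x => ((hV' x).mul (ds x)).sub (((hV x).mul (dc x)).const_mul z)) (by
    intro x hx
    rw [hc x ⟨hx.1, hx.2.le⟩]; ring)
  have k2 := const _ _ (fun x => ((hV' x).mul (dc x)).add (((hV x).mul (ds x)).const_mul z)) (by
    intro x hx
    rw [hc x ⟨hx.1, hx.2.le⟩]; ring)
  have hV0 : V 0 = 0 := by rw [← hc 0 ⟨le_rfl, hh.le⟩, h0]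
  have k3 : ∀ y ∈ Icc 0 h, z * c y = V' 0 * Complex.sin (z * y) := by
    intro y hy
    have a1 := k1 y hy
    have a2 := k2 y hy
    simp [hV0] at a1 a2
    rw [hc y hy]
    linear_combination Complex.sin (z * y) * a2 - Complex.cos (z * y) * a1
      - z * V y * Complex.sin_sq_add_cos_sq (z * y)
  intro y hy
  have b1 := k3 y hy
  have b2 := k3 h ⟨hh.le, le_rfl⟩
  apply mul_left_cancel₀ hz0
  rw [b1, ← mul_assoc, b2]
  field_simp

/-- Transverse frequency of the `n`-th mode. -/
def transFreq (κ h1 : ℝ) (n : ℕ) : ℂ := κ * csqrt (1 - nuHat κ h1 n ^ 2)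

lemma transFreq_sq {κ h1 : ℝ} (hκ : 0 < κ) (hh1 : 0 < h1) (n : ℕ) :
    transFreq κ h1 n ^ 2 = ((κ ^ 2 - sineFreq h1 n ^ 2 : ℝ) : ℂ) := by
  have : csqrt (1 - nuHat κ h1 n ^ 2) ^ 2 = ((1 - nuHat κ h1 n ^ 2 : ℝ) : ℂ) := by
    unfold csqrt
    have := Complex.cpow_nat_inv_pow ((1 - nuHat κ h1 n ^ 2 : ℝ) : ℂ) (n := 2) two_ne_zero
    rw [one_div]; exact_mod_cast this
  rw [transFreq, mul_pow, this, ← Complex.ofReal_pow, ← Complex.ofReal_mul]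
  congr 1
  unfold nuHat sineFreq
  field_simp

lemma sin_transFreq_ne_zero {κ h1 h2 : ℝ} (hκ : 0 < κ) (hh1 : 0 < h1) (hh2 : 0 < h2)
    (hA0 : A0cond κ h1 h2) (n : ℕ) : Complex.sin (transFreq κ h1 n * h2) ≠ 0 := by
  intro h
  obtain ⟨k, hk⟩ := Complex.sin_eq_zero_iff.1 h
  have h3 : transFreq κ h1 n ^ 2 * (h2 : ℂ) ^ 2 = (k * π) ^ 2 := by rw [← mul_pow, hk]
  rw [transFreq_sq hκ hh1] at h3
  have h4 : (κ ^ 2 - sineFreq h1 n ^ 2) * h2 ^ 2 = (k * π) ^ 2 := by exact_mod_cast h3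
  apply hA0 n k.natAbs
  have h5 : ((k.natAbs : ℕ) : ℝ) ^ 2 = (k : ℝ) ^ 2 := by
    rw [Nat.cast_natAbs]; simp
  rw [div_pow ((k.natAbs : ℝ) * π), mul_pow (k.natAbs : ℝ), h5, ← mul_pow, ← h4]
  unfold sineFreq
  field_simp
  ring

/-- `i`-th derivative of the tangential factor of the `n`-th mode. -/
def tanFactor (h1 : ℝ) (i n : ℕ) (x : ℝ) : ℝ :=
  sineFreq h1 n ^ i * sin (sineFreq h1 n * x + i * (π / 2))

/-- `j`-th derivative of the transverse factor of the `n`-th mode. -/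
def transFactor (κ h1 h2 : ℝ) (j n : ℕ) (y : ℝ) : ℂ :=
  transFreq κ h1 n ^ j * Complex.sin (transFreq κ h1 n * y + j * (π / 2)) /
    Complex.sin (transFreq κ h1 n * h2)

lemma hasDerivAt_tanFactor (h1 : ℝ) (i n : ℕ) (x : ℝ) :
    HasDerivAt (fun x => (tanFactor h1 i n x : ℂ)) (tanFactor h1 (i + 1) n x) x := by
  have l : HasDerivAt (fun x : ℝ => sineFreq h1 n * x + i * (π / 2)) (sineFreq h1 n) x := by
    simpa using ((hasDerivAt_id x).const_mul (sineFreq h1 n)).add_const ((i : ℝ) * (π / 2))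
  have := (l.sin.const_mul (sineFreq h1 n ^ i)).ofReal_comp
  convert! this using 2
  have : sineFreq h1 n * x + ((i + 1 : ℕ) : ℝ) * (π / 2)
      = sineFreq h1 n * x + i * (π / 2) + π / 2 := by push_cast; ring
  rw [tanFactor, this, sin_add_pi_div_two]
  ring

lemma hasDerivAt_transFactor (κ h1 h2 : ℝ) (j n : ℕ) (y : ℝ) :
    HasDerivAt (transFactor κ h1 h2 j n) (transFactor κ h1 h2 (j + 1) n y) y := by
  have l : HasDerivAt (fun y : ℝ => transFreq κ h1 n * y + j * (π / 2)) (transFreq κ h1 n) y := by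
    simpa using ((HasDerivAt.ofReal_comp (hasDerivAt_id y)).const_mul
      (transFreq κ h1 n)).add_const ((j : ℂ) * (π / 2))
  have := (((Complex.hasDerivAt_sin _).comp y l).const_mul (transFreq κ h1 n ^ j)).div_const
    (Complex.sin (transFreq κ h1 n * h2))
  convert! this using 1
  have : transFreq κ h1 n * y + ((j + 1 : ℕ) : ℂ) * (π / 2)
      = transFreq κ h1 n * y + j * (π / 2) + π / 2 := by push_cast; ring
  rw [transFactor, this, Complex.sin_add_pi_div_two]
  ring

lemma iterate_deriv_tanFactor (h1 : ℝ) (i n : ℕ) :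
    deriv^[i] (fun x => (tanFactor h1 0 n x : ℂ)) = fun x => (tanFactor h1 i n x : ℂ) := by
  induction i with
  | zero => rfl
  | succ i ih =>
    rw [Function.iterate_succ_apply', ih]
    exact funext fun x => (hasDerivAt_tanFactor h1 i n x).deriv

lemma iterate_deriv_transFactor (κ h1 h2 : ℝ) (j n : ℕ) :
    deriv^[j] (transFactor κ h1 h2 0 n) = transFactor κ h1 h2 j n := by
  induction j with
  | zero => rfl
  | succ j ih =>
    rw [Function.iterate_succ_apply', ih]
    exact funext fun x => (hasDerivAt_transFactor κ h1 h2 j n x).deriv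

lemma phiHat_eq {κ h1 h2 : ℝ} (hκ : 0 < κ) (n : ℕ) :
    phiHat κ h1 h2 n = fun p => (tanFactor h1 0 n p.1 : ℂ) * transFactor κ h1 h2 0 n p.2 := by
  have : κ * nuHat κ h1 n = sineFreq h1 n := by unfold nuHat sineFreq; field_simp
  funext p
  simp only [phiHat, this, tanFactor, transFactor, transFreq]
  push_cast
  simp only [pow_zero, zero_mul, add_zero, one_mul]
  rw [mul_div_assoc]
  congr 3 <;> ring

lemma pdM_phiHat {κ h1 h2 : ℝ} (hκ : 0 < κ) (i j n : ℕ) :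
    pdM i j (phiHat κ h1 h2 n) =
      fun p => (tanFactor h1 i n p.1 : ℂ) * transFactor κ h1 h2 j n p.2 := by
  rw [phiHat_eq hκ, pdM_mul_s5 i j (fun x => (tanFactor h1 0 n x : ℂ)), iterate_deriv_tanFactor,
    iterate_deriv_transFactor]

lemma WeakHelmholtz.sine_coeff_eq {κ h1 h2 : ℝ} (hκ : 0 < κ) (hh1 : 0 < h1) (hh2 : 0 < h2)
    (hA0 : A0cond κ h1 h2) {U : ℝ × ℝ → ℂ}
    (hU : Continuous U) (hw : WeakHelmholtz κ (Khat h1 h2) U)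
    (hl : ∀ y ∈ Icc 0 h2, U (0, y) = 0) (hr : ∀ y ∈ Icc 0 h2, U (h1, y) = 0)
    (hb : ∀ x ∈ Icc 0 h1, U (x, 0) = 0) (n : ℕ) :
    ∀ y ∈ Icc 0 h2, ∫ x in (0 : ℝ)..h1, U (x, y) * (sin (sineFreq h1 n * x) : ℝ) =
      (∫ x in (0 : ℝ)..h1, U (x, h2) * (sin (sineFreq h1 n * x) : ℝ)) *
        transFactor κ h1 h2 0 n y := by
  have cc : Continuous fun y => ∫ x in (0 : ℝ)..h1, U (x, y) * (sin (sineFreq h1 n * x) : ℝ) :=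
    continuous_uncurry_integral' (G := fun p => U p * (sin (sineFreq h1 n * p.1) : ℝ))
      (by fun_prop) _ _
  obtain ⟨V, V', hV, hV', hVeq⟩ := exists_classical_of_weak hh2 cc (cc.const_mul _)
    (fun ψ hψ => hw.sine_coeff hh1 hh2 hU hl hr n hψ)
  intro y hy
  have := eq_sin_of_ode hh2 (sin_transFreq_ne_zero hκ hh1 hh2 hA0 n) hV
    (by rw [transFreq_sq hκ hh1, Complex.ofReal_sub, Complex.ofReal_pow, Complex.ofReal_pow]; exact hV') hVeq (by
      rw [intervalIntegral.integral_congr (g := fun _ => (0 : ℂ))]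
      · simp
      · intro x hx
        rw [uIcc_of_le hh1.le] at hx
        simp [hb x hx]) y hy
  rw [this]
  simp [transFactor]

lemma fourier_two_mul_sub {h : ℝ} (hh : 0 < h) (n : ℤ) (x : ℝ) :
    fourier n ((x : ℝ) : AddCircle (2 * h)) - fourier n ((-x : ℝ) : AddCircle (2 * h))
      = 2 * Complex.I * ((sin (n * π / h * x) : ℝ) : ℂ) := by
  have hh' : (h : ℂ) ≠ 0 := by exact_mod_cast hh.ne'
  have e1 : (2 * π * Complex.I * n * (x : ℝ) / ((2 * h : ℝ) : ℂ) : ℂ)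
      = ((n * π / h * x : ℝ) : ℂ) * Complex.I := by
    push_cast; field_simp
  have e2 : (2 * π * Complex.I * n * ((-x : ℝ) : ℂ) / ((2 * h : ℝ) : ℂ) : ℂ)
      = -((n * π / h * x : ℝ) : ℂ) * Complex.I := by
    push_cast; field_simp
  rw [fourier_coe_apply, fourier_coe_apply, e1, e2, Complex.ofReal_sin, Complex.sin]
  linear_combination ((Complex.exp (((n * π / h * x : ℝ) : ℂ) * Complex.I)
    - Complex.exp (-((n * π / h * x : ℝ) : ℂ) * Complex.I))) * Complex.I_sq

/-- Pointwise convergence of the sine series of a continuous function with summable sine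
coefficients vanishing at both endpoints. -/
lemma hasSum_sine_series {h : ℝ} (hh : 0 < h) {f : ℝ → ℂ} (hf : Continuous f) (h0 : f 0 = 0)
    (h1 : f h = 0)
    (hs : Summable fun n : ℕ => ∫ x in (0 : ℝ)..h, f x * (sin (sineFreq h n * x) : ℝ)) :
    ∀ x ∈ Icc 0 h, HasSum (fun n : ℕ => (2 / h : ℂ) *
      (∫ x in (0 : ℝ)..h, f x * (sin (sineFreq h n * x) : ℝ)) * (sin (sineFreq h n * x) : ℝ))
      (f x) := by
  have : Fact (0 < 2 * h) := ⟨by linarith⟩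
  have hh' : (h : ℂ) ≠ 0 := by exact_mod_cast hh.ne'
  set E : ℝ → ℂ := fun x => if 0 ≤ x then f x else -f (-x) with hE
  have cE : Continuous E := Continuous.if_le hf (by fun_prop) continuous_const continuous_id
    (by rintro x rfl; simp [h0])
  have Epos : ∀ x, 0 ≤ x → E x = f x := fun x hx => by simp [hE, hx]
  have Eneg : ∀ x, 0 ≤ x → E (-x) = -f x := fun x hx => by
    rcases hx.eq_or_lt with rfl | hx'
    · simp [hE, h0]
    · simp [hE, hx']
  have hper : E (-h) = E (-h + 2 * h) := by
    rw [Eneg h hh.le, show -h + 2 * h = h by ring, Epos h hh.le, h1, neg_zero]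
  let F : C(AddCircle (2 * h), ℂ) := ⟨AddCircle.liftIco (2 * h) (-h) E,
    AddCircle.liftIco_continuous hper cE.continuousOn⟩
  have coeff : ∀ n : ℤ, fourierCoeff F n =
      -(Complex.I / h) * ∫ x in (0 : ℝ)..h, f x * (sin (n * π / h * x) : ℝ) := by
    intro n
    have hc : Continuous fun x : ℝ => fourier (-n) ((x : ℝ) : AddCircle (2 * h)) :=
      (map_continuous (fourier (-n))).comp (AddCircle.continuous_mk' _)
    change fourierCoeff (AddCircle.liftIco (2 * h) (-h) E) n = _
    rw [fourierCoeff_liftIco_eq, fourierCoeffOn_eq_integral]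
    rw [show -h + 2 * h = h by ring]
    have ii : ∀ a b : ℝ, IntervalIntegrable
        (fun x : ℝ => fourier (-n) ((x : ℝ) : AddCircle (2 * h)) • E x) volume a b := fun a b =>
      (hc.smul cE).intervalIntegrable _ _
    rw [intervalIntegral.integral_congr (g := fun x : ℝ =>
      fourier (-n) ((x : ℝ) : AddCircle (2 * h)) • E x) fun x _ => by
        simp only [fourier_coe_apply]; ring_nf]
    rw [← intervalIntegral.integral_add_adjacent_intervals (ii (-h) 0) (ii 0 h)]
    have sub := intervalIntegral.integral_comp_neg (a := 0) (b := h)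
      (fun x : ℝ => fourier (-n) ((x : ℝ) : AddCircle (2 * h)) • E x)
    rw [neg_zero] at sub
    rw [← sub, ← intervalIntegral.integral_add]
    · rw [intervalIntegral.integral_congr (g := fun x =>
        (-2 * Complex.I) * (f x * (sin (n * π / h * x) : ℝ)))]
      · rw [intervalIntegral.integral_const_mul, Complex.real_smul]
        push_cast
        field_simp
        ring
      · intro x hx
        rw [uIcc_of_le hh.le] at hx
        have := fourier_two_mul_sub hh (-n) x
        have e : sin (((-n : ℤ) : ℝ) * π / h * x) = - sin (n * π / h * x) := by
          rw [← sin_neg]; congr 1; push_cast; ring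
        rw [e] at this
        simp only [smul_eq_mul, Epos x hx.1, Eneg x hx.1]
        push_cast at this ⊢
        linear_combination f x * this
    · exact ((hc.comp continuous_neg).smul (cE.comp continuous_neg)).intervalIntegrable _ _
    · exact ii 0 h
  have cn : ∀ n : ℕ, fourierCoeff F n =
      -(Complex.I / h) * ∫ x in (0 : ℝ)..h, f x * (sin (sineFreq h n * x) : ℝ) := fun n => by
    rw [coeff]; simp [sineFreq]
  have cn' : ∀ n : ℕ, fourierCoeff F (-n) =
      (Complex.I / h) * ∫ x in (0 : ℝ)..h, f x * (sin (sineFreq h n * x) : ℝ) := fun n => by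
    rw [coeff, neg_mul, ← mul_neg, ← intervalIntegral.integral_neg]
    congr 2; funext x
    have : sin (((-n : ℤ) : ℝ) * π / h * x) = -sin (sineFreq h n * x) := by
      rw [sineFreq, ← sin_neg]; congr 1; push_cast; ring
    rw [this]; push_cast; ring
  have sumF : Summable (fourierCoeff F) := by
    apply Summable.of_nat_of_neg
    · simp only [cn]; exact hs.mul_left _
    · simp only [cn']; exact hs.mul_left _
  intro x hx
  have hx' : F ((x : ℝ) : AddCircle (2 * h)) = f x := by
    rcases eq_or_lt_of_le hx.2 with rfl | hlt
    · have : ((x : ℝ) : AddCircle (2 * x)) = ((-x : ℝ) : AddCircle (2 * x)) := by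
        rw [← AddCircle.coe_add_period (2 * x) (-x)]; congr 1; ring
      rw [this]
      change AddCircle.liftIco (2 * x) (-x) E ((-x : ℝ) : AddCircle (2 * x)) = _
      rw [AddCircle.liftIco_coe_apply ⟨le_rfl, by linarith⟩, Eneg x hh.le, h1, neg_zero]
    · change AddCircle.liftIco (2 * h) (-h) E x = _
      rw [AddCircle.liftIco_coe_apply ⟨by linarith [hx.1], by linarith⟩, Epos x hx.1]
  have HS := (has_pointwise_sum_fourier_series_of_summable sumF
    ((x : ℝ) : AddCircle (2 * h))).nat_add_neg
  have c0 : fourierCoeff F 0 = 0 := by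
    have := cn 0
    simpa [sineFreq] using this
  rw [hx', c0, zero_smul, add_zero] at HS
  convert! HS using 2 with n
  rw [cn, cn']
  have := fourier_two_mul_sub hh n x
  have en : fourier (-(n : ℤ)) ((x : ℝ) : AddCircle (2 * h))
      = fourier n ((-x : ℝ) : AddCircle (2 * h)) := by
    rw [fourier_coe_apply, fourier_coe_apply]; congr 1; push_cast; ring
  rw [en]
  simp only [smul_eq_mul]
  have e : sin ((n : ℤ) * π / h * x) = sin (sineFreq h n * x) := by simp [sineFreq]
  rw [e] at this
  set c := ∫ x in (0 : ℝ)..h, f x * (sin (sineFreq h n * x) : ℝ)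
  linear_combination (Complex.I / h * c) * this
    + 2 / h * c * (sin (sineFreq h n * x) : ℝ) * Complex.I_sq

lemma integral_cos_affine {h : ℝ} (hh : 0 < h) (k l : ℤ) (hk : k ≠ 0) :
    ∫ x in (0 : ℝ)..h, cos (k * π / h * x + l * π) = 0 := by
  have hk' : (k : ℝ) * π / h ≠ 0 :=
    div_ne_zero (mul_ne_zero (by exact_mod_cast hk) pi_ne_zero) hh.ne'
  rw [intervalIntegral.integral_comp_mul_add (fun t => cos t) hk', integral_cos]
  have : (k : ℝ) * π / h * h + l * π = ((k + l : ℤ) : ℝ) * π := by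
    push_cast; field_simp
  rw [this, sin_int_mul_pi, mul_zero, zero_add, sin_int_mul_pi]
  simp

lemma integral_sin_mul_sin {h : ℝ} (hh : 0 < h) (i : ℕ) {n m : ℕ} (hn : n + m ≠ 0) :
    ∫ x in (0 : ℝ)..h, sin (sineFreq h n * x + i * (π / 2)) * sin (sineFreq h m * x + i * (π / 2))
      = if n = m then h / 2 else 0 := by
  have e : ∀ x, sin (sineFreq h n * x + i * (π / 2)) * sin (sineFreq h m * x + i * (π / 2))
      = 2⁻¹ * (cos ((((n : ℤ) - m : ℤ) : ℝ) * π / h * x + ((0 : ℤ) : ℝ) * π)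
        - cos ((((n : ℤ) + m : ℤ) : ℝ) * π / h * x + ((i : ℤ) : ℝ) * π)) := by
    intro x
    have h1 : (((n : ℤ) - m : ℤ) : ℝ) * π / h * x + ((0 : ℤ) : ℝ) * π
        = (sineFreq h n * x + i * (π / 2)) - (sineFreq h m * x + i * (π / 2)) := by
      unfold sineFreq; push_cast; ring
    have h2 : (((n : ℤ) + m : ℤ) : ℝ) * π / h * x + ((i : ℤ) : ℝ) * π
        = (sineFreq h n * x + i * (π / 2)) + (sineFreq h m * x + i * (π / 2)) := by
      unfold sineFreq; push_cast; ring
    rw [h1, h2, cos_sub (_ + _) (_ + _), cos_add (_ + _) (_ + _)]; ring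
  simp only [e]
  rw [intervalIntegral.integral_const_mul, intervalIntegral.integral_sub
    (Continuous.intervalIntegrable (by fun_prop) _ _)
    (Continuous.intervalIntegrable (by fun_prop) _ _), integral_cos_affine hh (n + m) i (by omega)]
  split_ifs with h'
  · subst h'; simp; ring
  · rw [integral_cos_affine hh _ _ (by omega)]; simp

/-- Bessel's inequality for the shifted sine systems on `(0,h)`. -/
lemma summable_sq_sine_coeff {h : ℝ} (hh : 0 < h) {G : ℝ → ℂ} (hG : ContinuousOn G (Icc 0 h))
    (i : ℕ) : Summable fun n : ℕ =>
      ‖∫ x in (0 : ℝ)..h, G x * (sin (sineFreq h n * x + i * (π / 2)) : ℝ)‖ ^ 2 := by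
  set e : ℕ → ℝ → ℝ := fun n x => sin (sineFreq h n * x + i * (π / 2)) with he
  have ce : ∀ n, Continuous (e n) := fun n => by simp only [he]; fun_prop
  set c : ℕ → ℂ := fun n => ∫ x in (0 : ℝ)..h, G x * (e n x : ℝ) with hc
  change Summable fun n => ‖c n‖ ^ 2
  rw [← summable_nat_add_iff 1]
  have hG' : ContinuousOn G (uIcc 0 h) := by rwa [uIcc_of_le hh.le]
  apply summable_of_sum_range_le (c := h / 2 * ∫ x in (0 : ℝ)..h, ‖G x‖ ^ 2)
    (fun n => sq_nonneg _)
  intro K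
  set S : ℝ → ℂ := fun x => ∑ n ∈ Finset.range K, (2 / h : ℂ) * c (n + 1) * e (n + 1) x with hS
  have cS : Continuous S := by
    simp only [hS]
    exact continuous_finsetSum _ fun n _ => continuous_const.mul
      (Complex.continuous_ofReal.comp (ce _))
  have pos : 0 ≤ ∫ x in (0 : ℝ)..h, ‖G x - S x‖ ^ 2 :=
    intervalIntegral.integral_nonneg hh.le fun x _ => sq_nonneg _
  have hGS : ∫ x in (0 : ℝ)..h, G x * (starRingEnd ℂ) (S x)
      = ∑ n ∈ Finset.range K, (2 / h : ℂ) * ((‖c (n + 1)‖ ^ 2 : ℝ) : ℂ) := by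
    have : ∀ x, G x * (starRingEnd ℂ) (S x) = ∑ n ∈ Finset.range K,
        (2 / h : ℂ) * (starRingEnd ℂ) (c (n + 1)) * (G x * e (n + 1) x) := fun x => by
      simp only [hS, map_sum, map_mul, Complex.conj_ofReal, Finset.mul_sum, map_div₀, map_ofNat]
      exact Finset.sum_congr rfl fun n _ => by ring
    simp only [this]
    rw [intervalIntegral.integral_finsetSum]
    · refine Finset.sum_congr rfl fun n _ => ?_
      rw [intervalIntegral.integral_const_mul, mul_assoc, Complex.ofReal_pow,
        ← Complex.conj_mul']
    · intro n _
      exact (continuousOn_const.mul (hG'.mul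
        (Complex.continuous_ofReal.comp (ce _)).continuousOn)).intervalIntegrable
  have hSS : ∫ x in (0 : ℝ)..h, S x * (starRingEnd ℂ) (S x)
      = ∑ n ∈ Finset.range K, (2 / h : ℂ) * ((‖c (n + 1)‖ ^ 2 : ℝ) : ℂ) := by
    have : ∀ x, S x * (starRingEnd ℂ) (S x) = ∑ n ∈ Finset.range K, ∑ m ∈ Finset.range K,
        (2 / h : ℂ) * c (n + 1) * ((2 / h : ℂ) * (starRingEnd ℂ) (c (m + 1))) *
          ((e (n + 1) x * e (m + 1) x : ℝ) : ℂ) := fun x => by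
      simp only [hS, map_sum, map_mul, Complex.conj_ofReal, map_div₀, map_ofNat,
        Finset.sum_mul_sum]
      exact Finset.sum_congr rfl fun n _ => Finset.sum_congr rfl fun m _ => by push_cast; ring
    simp only [this]
    rw [intervalIntegral.integral_finsetSum]
    · refine Finset.sum_congr rfl fun n hn => ?_
      rw [intervalIntegral.integral_finsetSum]
      · simp only [intervalIntegral.integral_const_mul, intervalIntegral.integral_ofReal]
        have : ∀ m, ∫ x in (0 : ℝ)..h, e (n + 1) x * e (m + 1) x = if n = m then h / 2 else 0 :=
          fun m => by
            rw [integral_sin_mul_sin hh i (by omega)]; simp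
        simp only [this]
        rw [Finset.sum_eq_single_of_mem n hn]
        · rw [if_pos rfl, Complex.ofReal_pow, ← Complex.conj_mul']
          have hh' : (h : ℂ) ≠ 0 := by exact_mod_cast hh.ne'
          push_cast; field_simp
        · intro m _ hm
          rw [if_neg hm.symm]; simp
      · intro m _
        exact (continuous_const.mul (Complex.continuous_ofReal.comp
          ((ce _).mul (ce _)))).intervalIntegrable _ _
    · intro n _
      exact (continuous_finsetSum _ fun m _ => continuous_const.mul (Complex.continuous_ofReal.comp
          ((ce _).mul (ce _)))).intervalIntegrable _ _
  have expand : ∀ x, ‖G x - S x‖ ^ 2 = ‖G x‖ ^ 2 - 2 * (G x * (starRingEnd ℂ) (S x)).re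
      + (S x * (starRingEnd ℂ) (S x)).re := fun x => by
    rw [Complex.mul_conj, Complex.ofReal_re, ← Complex.normSq_eq_norm_sq,
      ← Complex.normSq_eq_norm_sq, Complex.normSq_sub]; ring
  have cGS : ContinuousOn (fun x => G x * (starRingEnd ℂ) (S x)) (uIcc 0 h) :=
    hG'.mul (Complex.continuous_conj.comp cS).continuousOn
  have cSS : Continuous (fun x => S x * (starRingEnd ℂ) (S x)) :=
    cS.mul (Complex.continuous_conj.comp cS)
  have r1 : ∫ x in (0 : ℝ)..h, (G x * (starRingEnd ℂ) (S x)).re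
      = ∑ n ∈ Finset.range K, 2 / h * ‖c (n + 1)‖ ^ 2 := by
    have := Complex.reCLM.intervalIntegral_comp_comm (cGS.intervalIntegrable (μ := volume))
    simp only [Complex.reCLM_apply] at this
    rw [this, hGS]; norm_cast
  have r2 : ∫ x in (0 : ℝ)..h, (S x * (starRingEnd ℂ) (S x)).re
      = ∑ n ∈ Finset.range K, 2 / h * ‖c (n + 1)‖ ^ 2 := by
    have := Complex.reCLM.intervalIntegral_comp_comm (cSS.intervalIntegrable (μ := volume) 0 h)
    simp only [Complex.reCLM_apply] at this
    rw [this, hSS]; norm_cast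
  simp only [expand] at pos
  have i1 : IntervalIntegrable (fun x => ‖G x‖ ^ 2) volume 0 h := (hG'.norm.pow 2).intervalIntegrable
  have i2 : IntervalIntegrable (fun x => 2 * (G x * (starRingEnd ℂ) (S x)).re) volume 0 h :=
    ((Complex.continuous_re.comp_continuousOn cGS).const_smul (2 : ℝ)).intervalIntegrable
  have i3 : IntervalIntegrable (fun x => (S x * (starRingEnd ℂ) (S x)).re) volume 0 h :=
    (Complex.continuous_re.comp cSS).intervalIntegrable _ _
  rw [intervalIntegral.integral_add (i1.sub i2) i3,
    intervalIntegral.integral_sub i1 i2, intervalIntegral.integral_const_mul, r1, r2,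
    ← Finset.mul_sum] at pos
  have : 2 / h * ∑ n ∈ Finset.range K, ‖c (n + 1)‖ ^ 2 ≤ ∫ x in (0 : ℝ)..h, ‖G x‖ ^ 2 := by
    linarith
  have h3 := mul_le_mul_of_nonneg_left this (by positivity : 0 ≤ h / 2)
  rw [← mul_assoc, show h / 2 * (2 / h) = 1 by field_simp, one_mul] at h3
  exact h3

/-- Integration by parts for the shifted sine coefficients of iterated derivatives. -/
lemma sine_coeff_succ {h : ℝ} (hh : 0 < h) {N M : ℕ} {g : ℝ → ℂ}
    (hg : ContDiffOn ℝ M g (Icc 0 h))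
    (e0 : ∀ j < N, iteratedDerivWithin (2 * j) g (Icc 0 h) 0 = 0)
    (e1 : ∀ j < N, iteratedDerivWithin (2 * j) g (Icc 0 h) h = 0)
    {r : ℕ} (hr : r < 2 * N) (hrM : r < M) (n : ℕ) :
    ∫ x in (0 : ℝ)..h, iteratedDerivWithin (r + 1) g (Icc 0 h) x *
        (sin (sineFreq h n * x + (r + 1 : ℕ) * (π / 2)) : ℝ)
      = sineFreq h n * ∫ x in (0 : ℝ)..h, iteratedDerivWithin r g (Icc 0 h) x *
        (sin (sineFreq h n * x + r * (π / 2)) : ℝ) := by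
  have uD : UniqueDiffOn ℝ (Icc 0 h) := uniqueDiffOn_Icc hh
  have c : ∀ k ≤ M, ContinuousOn (iteratedDerivWithin k g (Icc 0 h)) (Icc 0 h) := fun k hk =>
    hg.continuousOn_iteratedDerivWithin (by exact_mod_cast hk) uD
  have d : ∀ x ∈ Ioo 0 h, HasDerivAt (iteratedDerivWithin r g (Icc 0 h))
      (iteratedDerivWithin (r + 1) g (Icc 0 h) x) x := fun x hx => by
    have h1 := (hg.differentiableOn_iteratedDerivWithin (by exact_mod_cast hrM) uD) x
      (Ioo_subset_Icc_self hx)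
    have h2 := h1.hasDerivWithinAt
    rw [← iteratedDerivWithin_succ] at h2
    exact h2.hasDerivAt (Icc_mem_nhds hx.1 hx.2)
  set s : ℝ → ℂ := fun x => ((sin (sineFreq h n * x + (r + 1 : ℕ) * (π / 2)) : ℝ) : ℂ) with hs
  set s' : ℝ → ℂ := fun x => ((sin (sineFreq h n * x + r * (π / 2)) : ℝ) : ℂ) with hs'
  have ds : ∀ x, HasDerivAt s (-(sineFreq h n : ℂ) * s' x) x := fun x => by
    have h1 : HasDerivAt (fun x : ℝ => sin (sineFreq h n * x + (r + 1 : ℕ) * (π / 2)))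
        (-sineFreq h n * sin (sineFreq h n * x + r * (π / 2))) x := by
      have := (((hasDerivAt_id x).const_mul (sineFreq h n)).add_const
        ((r + 1 : ℕ) * (π / 2))).sin
      convert! this using 1
      rw [show sineFreq h n * id x + ((r + 1 : ℕ) : ℝ) * (π / 2)
        = (sineFreq h n * x + r * (π / 2)) + π / 2 by push_cast; simp; ring, cos_add_pi_div_two]
      ring
    have := h1.ofReal_comp
    convert! this using 1
    simp [hs']
  have cs : Continuous s := continuous_iff_continuousAt.2 fun x => (ds x).continuousAt
  have cs' : Continuous s' := by simp only [hs']; fun_prop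
  have i1 : IntervalIntegrable (fun x => iteratedDerivWithin (r + 1) g (Icc 0 h) x * s x)
      volume 0 h := by
    apply ContinuousOn.intervalIntegrable
    rw [uIcc_of_le hh.le]
    exact (c _ hrM).mul cs.continuousOn
  have i2 : IntervalIntegrable (fun x => iteratedDerivWithin r g (Icc 0 h) x *
      (-(sineFreq h n : ℂ) * s' x)) volume 0 h := by
    apply ContinuousOn.intervalIntegrable
    rw [uIcc_of_le hh.le]
    exact (c _ hrM.le).mul (continuous_const.mul cs').continuousOn
  have key := intervalIntegral.integral_eq_sub_of_hasDerivAt_of_le hh.le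
    ((c _ hrM.le).mul cs.continuousOn) (fun x hx => (d x hx).mul (ds x)) (i1.add i2)
  rw [intervalIntegral.integral_add i1 i2] at key
  have b : iteratedDerivWithin r g (Icc 0 h) h * s h -
      iteratedDerivWithin r g (Icc 0 h) 0 * s 0 = 0 := by
    rcases Nat.even_or_odd' r with ⟨k, rfl | rfl⟩
    · rw [e0 k (by omega), e1 k (by omega)]; simp
    · have a0 : s 0 = 0 := by
        simp only [hs]
        rw [show sineFreq h n * 0 + ((2 * k + 1 + 1 : ℕ) : ℝ) * (π / 2) = ((k + 1 : ℕ) : ℝ) * π by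
          push_cast; ring, sin_nat_mul_pi]; simp
      have a1 : s h = 0 := by
        simp only [hs, sineFreq]
        rw [show n * π / h * h + ((2 * k + 1 + 1 : ℕ) : ℝ) * (π / 2)
          = ((n + (k + 1) : ℕ) : ℝ) * π by push_cast; field_simp; ring, sin_nat_mul_pi]; simp
      rw [a0, a1]; simp
  simp only [Pi.mul_apply] at key
  rw [b] at key
  have : ∀ x, iteratedDerivWithin r g (Icc 0 h) x * (-(sineFreq h n : ℂ) * s' x)
    = -(sineFreq h n : ℂ) * (iteratedDerivWithin r g (Icc 0 h) x * s' x) := fun x => by ring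
  simp only [this] at key
  rw [intervalIntegral.integral_const_mul] at key
  linear_combination key

lemma sine_coeff_pow {h : ℝ} (hh : 0 < h) {N M : ℕ} {g : ℝ → ℂ}
    (hg : ContDiffOn ℝ M g (Icc 0 h))
    (e0 : ∀ j < N, iteratedDerivWithin (2 * j) g (Icc 0 h) 0 = 0)
    (e1 : ∀ j < N, iteratedDerivWithin (2 * j) g (Icc 0 h) h = 0) (n : ℕ) :
    ∀ {r : ℕ}, r ≤ 2 * N → r ≤ M →
    ∫ x in (0 : ℝ)..h, iteratedDerivWithin r g (Icc 0 h) x *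
        (sin (sineFreq h n * x + r * (π / 2)) : ℝ)
      = sineFreq h n ^ r * ∫ x in (0 : ℝ)..h, g x * (sin (sineFreq h n * x) : ℝ)
  | 0, _, _ => by simp
  | r + 1, hr, hrM => by
    rw [sine_coeff_succ hh hg e0 e1 (by omega) (by omega), sine_coeff_pow hh hg e0 e1 n
      (by omega) (by omega)]
    push_cast; ring

lemma summable_sq_mul_sine_coeff {h : ℝ} (hh : 0 < h) {N M : ℕ} {g : ℝ → ℂ}
    (hg : ContDiffOn ℝ M g (Icc 0 h))
    (e0 : ∀ j < N, iteratedDerivWithin (2 * j) g (Icc 0 h) 0 = 0)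
    (e1 : ∀ j < N, iteratedDerivWithin (2 * j) g (Icc 0 h) h = 0)
    {r : ℕ} (hr : r ≤ 2 * N) (hrM : r ≤ M) :
    Summable fun n : ℕ => sineFreq h n ^ (2 * r) *
      ‖∫ x in (0 : ℝ)..h, g x * (sin (sineFreq h n * x) : ℝ)‖ ^ 2 := by
  refine (summable_sq_sine_coeff hh (hg.continuousOn_iteratedDerivWithin
    (by exact_mod_cast hrM) (uniqueDiffOn_Icc hh) : ContinuousOn (iteratedDerivWithin r g (Icc 0 h)) _) r).congr fun n => ?_
  rw [sine_coeff_pow hh hg e0 e1 n hr hrM, norm_mul, mul_pow, norm_pow, Complex.norm_real,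
    ← pow_mul, mul_comm r 2, pow_mul, pow_mul, Real.norm_eq_abs, sq_abs]

lemma norm_exp_mul_I_add_norm_exp_neg_mul_I_le (w : ℂ) :
    ‖Complex.exp (-w * Complex.I)‖ + ‖Complex.exp (w * Complex.I)‖ ≤ 2 * exp |w.im| := by
  rw [Complex.norm_exp, Complex.norm_exp]
  have h1 : (-w * Complex.I).re ≤ |w.im| := by simpa using le_abs_self w.im
  have h2 : (w * Complex.I).re ≤ |w.im| := by simpa using neg_le_abs w.im
  linarith [exp_le_exp.2 h1, exp_le_exp.2 h2]

lemma norm_sin_le_exp (w : ℂ) : ‖Complex.sin w‖ ≤ exp |w.im| := by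
  rw [Complex.sin, norm_div, norm_mul, Complex.norm_I, mul_one, Complex.norm_ofNat,
    div_le_iff₀ two_pos, mul_comm (exp _)]
  exact (norm_sub_le _ _).trans (norm_exp_mul_I_add_norm_exp_neg_mul_I_le w)

lemma sinh_abs_im_le_norm_sin (w : ℂ) : sinh |w.im| ≤ ‖Complex.sin w‖ := by
  rw [Complex.sin, norm_div, norm_mul, Complex.norm_I, mul_one, Complex.norm_ofNat, sinh_eq]
  gcongr
  have := abs_norm_sub_norm_le (Complex.exp (-w * Complex.I)) (Complex.exp (w * Complex.I))
  refine le_trans ?_ this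
  rw [Complex.norm_exp, Complex.norm_exp]
  have e1 : (-w * Complex.I).re = w.im := by simp
  have e2 : (w * Complex.I).re = -w.im := by simp
  rw [e1, e2]
  rcases abs_cases w.im with ⟨h, _⟩ | ⟨h, _⟩ <;> rw [h]
  · exact le_abs_self _
  · rw [neg_neg, abs_sub_comm]; exact le_abs_self _

lemma sineFreq_nonneg {h : ℝ} (hh : 0 < h) (n : ℕ) : 0 ≤ sineFreq h n := by
  unfold sineFreq; positivity

lemma abs_tanFactor_le {h1 : ℝ} (hh1 : 0 < h1) (i n : ℕ) (x : ℝ) :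
    |tanFactor h1 i n x| ≤ sineFreq h1 n ^ i := by
  have := pow_nonneg (sineFreq_nonneg hh1 n) i
  rw [tanFactor, abs_mul, abs_of_nonneg this]
  exact mul_le_of_le_one_right this (abs_sin_le_one _)

lemma norm_transFreq_le {κ h1 : ℝ} (hκ : 0 < κ) (hh1 : 0 < h1) (n : ℕ) :
    ‖transFreq κ h1 n‖ ≤ κ + sineFreq h1 n := by
  have h0 := sineFreq_nonneg hh1 n
  refine le_of_pow_le_pow_left₀ two_ne_zero (by positivity) ?_
  rw [← norm_pow, transFreq_sq hκ hh1, Complex.norm_real, Real.norm_eq_abs, abs_le]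
  constructor <;> nlinarith [mul_nonneg hκ.le h0]

lemma sub_le_abs_im_transFreq {κ h1 : ℝ} (hκ : 0 < κ) (hh1 : 0 < h1) (n : ℕ) :
    sineFreq h1 n - κ ≤ |(transFreq κ h1 n).im| := by
  rcases le_or_gt (sineFreq h1 n) κ with h | h
  · exact (sub_nonpos.2 h).trans (abs_nonneg _)
  have h2 := transFreq_sq hκ hh1 n
  set z := transFreq κ h1 n
  have hre := congrArg Complex.re h2
  simp only [pow_two, Complex.mul_re, Complex.ofReal_re] at hre
  refine le_of_pow_le_pow_left₀ two_ne_zero (abs_nonneg _) ?_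
  rw [sq_abs]
  nlinarith [mul_self_nonneg z.re]

/-- Exponential decay of the transverse factors away from the top edge. -/
lemma exists_norm_transFactor_le {κ h1 h2 : ℝ} (hκ : 0 < κ) (hh1 : 0 < h1) (hh2 : 0 < h2)
    (hA0 : A0cond κ h1 h2) : ∃ B : ℝ, 0 ≤ B ∧ ∀ (j n : ℕ), ∀ y ∈ Icc 0 h2,
      ‖transFactor κ h1 h2 j n y‖ ≤
        B * ‖transFreq κ h1 n‖ ^ j * exp (-(|(transFreq κ h1 n).im| * (h2 - y))) := by
  set ρ : ℕ → ℝ := fun n => exp (|(transFreq κ h1 n).im| * h2) /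
    ‖Complex.sin (transFreq κ h1 n * h2)‖ with hρ
  have ev : ∀ᶠ n in Filter.atTop, ρ n ≤ 4 := by
    have t : Filter.Tendsto (fun n : ℕ => (n : ℝ) * (π / h1)) Filter.atTop Filter.atTop :=
      tendsto_natCast_atTop_atTop.atTop_mul_const (by positivity)
    filter_upwards [t.eventually_ge_atTop (κ + 1 / h2)] with n hn
    have a : 1 / h2 ≤ |(transFreq κ h1 n).im| := by
      refine le_trans ?_ (sub_le_abs_im_transFreq hκ hh1 n)
      rw [sineFreq, mul_div_assoc]; linarith
    have a' : 1 ≤ |(transFreq κ h1 n).im| * h2 := by rwa [div_le_iff₀ hh2] at a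
    have b := sinh_abs_im_le_norm_sin (transFreq κ h1 n * h2)
    have im : (transFreq κ h1 n * h2).im = (transFreq κ h1 n).im * h2 := by simp
    rw [im, abs_mul, abs_of_pos hh2, sinh_eq] at b
    simp only [hρ]
    set t := |(transFreq κ h1 n).im| * h2
    rw [div_le_iff₀ (norm_pos_iff.2 (sin_transFreq_ne_zero hκ hh1 hh2 hA0 n))]
    have e1 : exp t * exp (-t) = 1 := by rw [← exp_add]; simp
    have e2 : 2 ≤ exp t := by linarith [add_one_le_exp t]
    have e3 : exp (-t) ≤ exp t / 2 := by nlinarith [exp_pos (-t)]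
    linarith
  obtain ⟨B, hB⟩ := (Filter.isBoundedUnder_of_eventually_le ev).bddAbove_range
  have hB' : ∀ n, ρ n ≤ B := fun n => hB (mem_range_self n)
  refine ⟨B, le_trans (by simp only [hρ]; positivity) (hB' 0), fun j n y hy => ?_⟩
  rw [transFactor, norm_div, norm_mul, norm_pow]
  have s := norm_sin_le_exp (transFreq κ h1 n * y + j * (π / 2))
  have im : (transFreq κ h1 n * y + j * (π / 2)).im = (transFreq κ h1 n).im * y := by
    rw [show (j * (π / 2) : ℂ) = ((j * (π / 2) : ℝ) : ℂ) by push_cast; ring]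
    simp
  rw [im, abs_mul, abs_of_nonneg hy.1] at s
  calc ‖transFreq κ h1 n‖ ^ j * ‖Complex.sin (transFreq κ h1 n * y + j * (π / 2))‖ /
        ‖Complex.sin (transFreq κ h1 n * h2)‖
      ≤ ‖transFreq κ h1 n‖ ^ j * exp (|(transFreq κ h1 n).im| * y) /
        ‖Complex.sin (transFreq κ h1 n * h2)‖ := by gcongr
    _ = ρ n * ‖transFreq κ h1 n‖ ^ j * exp (-(|(transFreq κ h1 n).im| * (h2 - y))) := by
      have : exp (|(transFreq κ h1 n).im| * y) = exp (|(transFreq κ h1 n).im| * h2) *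
        exp (-(|(transFreq κ h1 n).im| * (h2 - y))) := by rw [← exp_add]; ring_nf
      rw [this]; simp only [hρ]; ring
    _ ≤ _ := by gcongr; exact hB' n

lemma exists_summable_norm_transFactor_le {κ h1 h2 : ℝ} (hκ : 0 < κ) (hh1 : 0 < h1) (hh2 : 0 < h2)
    (hA0 : A0cond κ h1 h2) (i j : ℕ) {y1 : ℝ} (hy1 : y1 < h2) :
    ∃ m : ℕ → ℝ, Summable m ∧ ∀ n, ∀ y ∈ Icc 0 y1,
      sineFreq h1 n ^ i * ‖transFactor κ h1 h2 j n y‖ ≤ m n := by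
  obtain ⟨B, hB0, hB⟩ := exists_norm_transFactor_le hκ hh1 hh2 hA0
  set δ := h2 - y1
  have hδ : 0 < δ := sub_pos.2 hy1
  obtain ⟨q, hqe⟩ : ∃ q, q = exp (-(π / h1 * δ)) := ⟨_, rfl⟩
  have q0 : 0 < q := hqe ▸ exp_pos _
  have hq : ‖q‖ < 1 := by
    rw [Real.norm_eq_abs, abs_of_pos q0, hqe, exp_lt_one_iff]
    have : 0 < π / h1 * δ := by positivity
    linarith
  refine ⟨fun n => B * exp (κ * δ) * ((κ + sineFreq h1 n) ^ (i + j) * q ^ n), ?_, ?_⟩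
  · apply Summable.mul_left
    have S0 : Summable fun n : ℕ => (n : ℝ) ^ (i + j) * q ^ n :=
      summable_pow_mul_geometric_of_norm_lt_one (i + j) hq
    have S1 : Summable fun n : ℕ => ((n + 1 : ℕ) : ℝ) ^ (i + j) * q ^ (n + 1) :=
      (summable_nat_add_iff (f := fun n : ℕ => (n : ℝ) ^ (i + j) * q ^ n) 1).2 S0
    have S := S1.mul_left ((κ + π / h1) ^ (i + j) * q⁻¹)
    refine Summable.of_nonneg_of_le (fun n => ?_) (fun n => ?_) S
    · have := sineFreq_nonneg hh1 n
      positivity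
    · have h0 := sineFreq_nonneg hh1 n
      have : κ + sineFreq h1 n ≤ (κ + π / h1) * (n + 1 : ℕ) := by
        rw [sineFreq]; push_cast
        have : 0 ≤ κ * n + π / h1 := by positivity
        have e : n * π / h1 = π / h1 * n := by ring
        rw [e]; nlinarith
      calc (κ + sineFreq h1 n) ^ (i + j) * q ^ n
          ≤ ((κ + π / h1) * (n + 1 : ℕ)) ^ (i + j) * q ^ n := by gcongr
        _ = _ := by rw [mul_pow, pow_succ]; field_simp
  · intro n y hy
    have h0 := sineFreq_nonneg hh1 n
    have b := hB j n y ⟨hy.1, hy.2.trans hy1.le⟩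
    have d := sub_le_abs_im_transFreq hκ hh1 n
    have c : exp (-(|(transFreq κ h1 n).im| * (h2 - y))) ≤ exp (κ * δ) * q ^ n := by
      rw [hqe, ← exp_nat_mul, ← exp_add, exp_le_exp]
      have e : n * -(π / h1 * δ) = -(sineFreq h1 n * δ) := by rw [sineFreq]; ring
      rw [e]
      have : δ ≤ h2 - y := by linarith [hy.2]
      nlinarith [abs_nonneg (transFreq κ h1 n).im]
    calc sineFreq h1 n ^ i * ‖transFactor κ h1 h2 j n y‖
        ≤ (κ + sineFreq h1 n) ^ i * (B * (κ + sineFreq h1 n) ^ j * (exp (κ * δ) * q ^ n)) := by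
          gcongr
          · linarith
          · refine b.trans ?_
            gcongr
            exact norm_transFreq_le hκ hh1 n
      _ = _ := by ring

/-- Formal mixed derivative of order `(i, j)` of the mode expansion with coefficients `b`. -/
def modeSeries (κ h1 h2 : ℝ) (b : ℕ → ℂ) (i j : ℕ) (p : ℝ × ℝ) : ℂ :=
  ∑' n, b n * ((tanFactor h1 i n p.1 : ℂ) * transFactor κ h1 h2 j n p.2)

lemma exists_summable_norm_coeff_mul_mode_le {κ h1 h2 : ℝ} (hκ : 0 < κ) (hh1 : 0 < h1)
    (hh2 : 0 < h2) (hA0 : A0cond κ h1 h2) {b : ℕ → ℂ} {C : ℝ} (hb : ∀ n, ‖b n‖ ≤ C) (i j : ℕ)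
    {y1 : ℝ} (hy1 : y1 < h2) :
    ∃ m : ℕ → ℝ, Summable m ∧ ∀ n x, ∀ y ∈ Icc 0 y1,
      ‖b n * ((tanFactor h1 i n x : ℂ) * transFactor κ h1 h2 j n y)‖ ≤ m n := by
  obtain ⟨m, hm, hle⟩ := exists_summable_norm_transFactor_le hκ hh1 hh2 hA0 i j hy1
  refine ⟨fun n => C * m n, hm.mul_left C, fun n x y hy => ?_⟩
  have h := mul_le_mul_of_nonneg_right (abs_tanFactor_le hh1 i n x)
    (norm_nonneg (transFactor κ h1 h2 j n y))
  rw [norm_mul, norm_mul, Complex.norm_real, Real.norm_eq_abs]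
  exact mul_le_mul (hb n) (h.trans (hle n y hy)) (by positivity) ((norm_nonneg _).trans (hb n))

lemma summable_modeSeries {κ h1 h2 : ℝ} (hκ : 0 < κ) (hh1 : 0 < h1)
    (hh2 : 0 < h2) (hA0 : A0cond κ h1 h2) {b : ℕ → ℂ} {C : ℝ} (hb : ∀ n, ‖b n‖ ≤ C) (i j : ℕ)
    (x : ℝ) {y : ℝ} (hy : y ∈ Ioo 0 h2) :
    Summable fun n => b n * ((tanFactor h1 i n x : ℂ) * transFactor κ h1 h2 j n y) := by
  obtain ⟨m, hm, hle⟩ := exists_summable_norm_coeff_mul_mode_le hκ hh1 hh2 hA0 hb i j hy.2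
  exact Summable.of_norm_bounded hm fun n => hle n x y ⟨hy.1.le, le_rfl⟩

lemma hasDerivAt_modeSeries_fst {κ h1 h2 : ℝ} (hκ : 0 < κ) (hh1 : 0 < h1)
    (hh2 : 0 < h2) (hA0 : A0cond κ h1 h2) {b : ℕ → ℂ} {C : ℝ} (hb : ∀ n, ‖b n‖ ≤ C) (i j : ℕ)
    (x : ℝ) {y : ℝ} (hy : y ∈ Ioo 0 h2) :
    HasDerivAt (fun t => modeSeries κ h1 h2 b i j (t, y))
      (modeSeries κ h1 h2 b (i + 1) j (x, y)) x := by
  obtain ⟨m, hm, hle⟩ := exists_summable_norm_coeff_mul_mode_le hκ hh1 hh2 hA0 hb (i + 1) j hy.2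
  exact hasDerivAt_tsum_of_isPreconnected hm isOpen_univ isPreconnected_univ
    (fun n t _ => ((hasDerivAt_tanFactor h1 i n t).mul_const _).const_mul (b n))
    (fun n t _ => hle n t y ⟨hy.1.le, le_rfl⟩) (mem_univ x)
    (summable_modeSeries hκ hh1 hh2 hA0 hb i j x hy) (mem_univ x)

lemma hasDerivAt_modeSeries_snd {κ h1 h2 : ℝ} (hκ : 0 < κ) (hh1 : 0 < h1)
    (hh2 : 0 < h2) (hA0 : A0cond κ h1 h2) {b : ℕ → ℂ} {C : ℝ} (hb : ∀ n, ‖b n‖ ≤ C) (i j : ℕ)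
    (x : ℝ) {y : ℝ} (hy : y ∈ Ioo 0 h2) :
    HasDerivAt (fun t => modeSeries κ h1 h2 b i j (x, t))
      (modeSeries κ h1 h2 b i (j + 1) (x, y)) y := by
  obtain ⟨y1, h, h'⟩ := exists_between hy.2
  obtain ⟨m, hm, hle⟩ := exists_summable_norm_coeff_mul_mode_le hκ hh1 hh2 hA0 hb i (j + 1) h'
  exact hasDerivAt_tsum_of_isPreconnected hm isOpen_Ioo isPreconnected_Ioo
    (fun n t _ => ((hasDerivAt_transFactor κ h1 h2 j n t).const_mul _).const_mul (b n))
    (fun n t ht => hle n x t (Ioo_subset_Icc_self ht)) ⟨hy.1, h⟩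
    (summable_modeSeries hκ hh1 hh2 hA0 hb i j x hy) ⟨hy.1, h⟩

lemma eqOn_pd1 {h1 h2 : ℝ} {f g : ℝ × ℝ → ℂ} (h : EqOn f g (Khat h1 h2)) :
    EqOn (pd1 f) (pd1 g) (Khat h1 h2) := fun p hp => by
  apply Filter.EventuallyEq.deriv_eq
  filter_upwards [isOpen_Ioo.mem_nhds hp.1] with t ht using h ⟨ht, hp.2⟩

lemma eqOn_pd2 {h1 h2 : ℝ} {f g : ℝ × ℝ → ℂ} (h : EqOn f g (Khat h1 h2)) :
    EqOn (pd2 f) (pd2 g) (Khat h1 h2) := fun p hp => by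
  apply Filter.EventuallyEq.deriv_eq
  filter_upwards [isOpen_Ioo.mem_nhds hp.2] with t ht using h ⟨hp.1, ht⟩

/-- Mode expansions may be differentiated termwise inside the rectangle. -/
lemma eqOn_pdM_modeSeries {κ h1 h2 : ℝ} (hκ : 0 < κ) (hh1 : 0 < h1)
    (hh2 : 0 < h2) (hA0 : A0cond κ h1 h2) {b : ℕ → ℂ} {C : ℝ} (hb : ∀ n, ‖b n‖ ≤ C)
    {f : ℝ × ℝ → ℂ} (hf : EqOn f (modeSeries κ h1 h2 b 0 0) (Khat h1 h2)) (i j : ℕ) :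
    EqOn (pdM i j f) (modeSeries κ h1 h2 b i j) (Khat h1 h2) := by
  unfold pdM
  induction i with
  | zero =>
    induction j with
    | zero => exact hf
    | succ j ih =>
      rw [Function.iterate_zero, id, Function.iterate_succ_apply'] at *
      exact (eqOn_pd2 ih).trans fun p hp =>
        (hasDerivAt_modeSeries_snd hκ hh1 hh2 hA0 hb 0 j p.1 hp.2).deriv
  | succ i ih =>
    rw [Function.iterate_succ_apply']
    exact (eqOn_pd1 ih).trans fun p hp =>
      (hasDerivAt_modeSeries_fst hκ hh1 hh2 hA0 hb i j p.1 hp.2).deriv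

lemma transFactor_top {κ h1 h2 : ℝ} (hκ : 0 < κ) (hh1 : 0 < h1)
    (hh2 : 0 < h2) (hA0 : A0cond κ h1 h2) (n : ℕ) : transFactor κ h1 h2 0 n h2 = 1 := by
  have := sin_transFreq_ne_zero hκ hh1 hh2 hA0 n
  simp [transFactor, div_self this]

/-- Coefficients of the sine series of the trace on the top edge. -/
def traceCoeff (h1 h2 : ℝ) (u : ℝ × ℝ → ℂ) (n : ℕ) : ℂ :=
  (2 / h1 : ℂ) * ∫ x in (0 : ℝ)..h1, traceTop h2 u x * (sin (sineFreq h1 n * x) : ℝ)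

lemma traceCoeff_zero (h1 h2 : ℝ) (u : ℝ × ℝ → ℂ) : traceCoeff h1 h2 u 0 = 0 := by
  simp [traceCoeff, sineFreq]

lemma SLoc.summable_traceCoeff {κ h1 h2 : ℝ} (hh1 : 0 < h1) {N M : ℕ} {u : ℝ × ℝ → ℂ}
    (hu : SLoc κ h1 h2 N M u) {r : ℕ} (hr : r ≤ 2 * N) (hrM : r ≤ M) :
    Summable fun n => sineFreq h1 n ^ (2 * r) * ‖traceCoeff h1 h2 u n‖ ^ 2 := by
  refine ((summable_sq_mul_sine_coeff hh1 hu.traceReg hu.endpt0 hu.endpt1 hr hrM).mul_left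
    (‖(2 / h1 : ℂ)‖ ^ 2)).congr fun n => ?_
  rw [traceCoeff, norm_mul]; ring

lemma SLoc.exists_norm_traceCoeff_le {κ h1 h2 : ℝ} (hh1 : 0 < h1) {N M : ℕ} {u : ℝ × ℝ → ℂ}
    (hu : SLoc κ h1 h2 N M u) : ∃ C, ∀ n, ‖traceCoeff h1 h2 u n‖ ≤ C := by
  have := (hu.summable_traceCoeff hh1 (Nat.zero_le _) (Nat.zero_le _)).tendsto_atTop_zero
  obtain ⟨C, hC⟩ := this.bddAbove_range
  refine ⟨1 + C, fun n => ?_⟩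
  have h : ‖traceCoeff h1 h2 u n‖ ^ 2 ≤ C := by
    have := hC (mem_range_self n)
    simpa using this
  nlinarith [sq_nonneg (‖traceCoeff h1 h2 u n‖ - 1)]

/-- A member of the solution class is the sum of its mode expansion. -/
lemma SLoc.eqOn_modeSeries {κ h1 h2 : ℝ} (hκ : 0 < κ) (hh1 : 0 < h1)
    (hh2 : 0 < h2) (hA0 : A0cond κ h1 h2) {N M : ℕ} {u : ℝ × ℝ → ℂ}
    (hu : SLoc κ h1 h2 N M u) :
    EqOn u (modeSeries κ h1 h2 (traceCoeff h1 h2 u) 0 0) (Khat h1 h2) := by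
  obtain ⟨C, hC⟩ := hu.exists_norm_traceCoeff_le hh1
  set U : ℝ × ℝ → ℂ := fun p => u (projIcc 0 h1 hh1.le p.1, projIcc 0 h2 hh2.le p.2) with hUdef
  have hU : Continuous U := by
    apply hu.cont.comp_continuous
    · exact (continuous_subtype_val.comp (continuous_projIcc.comp continuous_fst)).prodMk
        (continuous_subtype_val.comp (continuous_projIcc.comp continuous_snd))
    · exact fun p => ⟨(projIcc 0 h1 hh1.le p.1).2, (projIcc 0 h2 hh2.le p.2).2⟩
  have hUu : ∀ x ∈ Icc 0 h1, ∀ y ∈ Icc 0 h2, U (x, y) = u (x, y) := fun x hx y hy => by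
    simp only [hUdef, projIcc_of_mem hh1.le hx, projIcc_of_mem hh2.le hy]
  have hK : EqOn U u (Khat h1 h2) := fun p hp =>
    hUu p.1 (Ioo_subset_Icc_self hp.1) p.2 (Ioo_subset_Icc_self hp.2)
  have mK : MeasurableSet (Khat h1 h2) := measurableSet_Ioo.prod measurableSet_Ioo
  have hw : WeakHelmholtz κ (Khat h1 h2) U := by
    refine ⟨hu.helm.1.congr_fun hK.symm mK, fun φ h h' h'' => ?_⟩
    rw [← hu.helm.2 φ h h' h'']
    exact setIntegral_congr_fun mK fun p hp => by simp only [hK hp]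
  have z1 : (0 : ℝ) ∈ Icc 0 h1 := ⟨le_rfl, hh1.le⟩
  have o1 : h1 ∈ Icc 0 h1 := ⟨hh1.le, le_rfl⟩
  have z2 : (0 : ℝ) ∈ Icc 0 h2 := ⟨le_rfl, hh2.le⟩
  have o2 : h2 ∈ Icc 0 h2 := ⟨hh2.le, le_rfl⟩
  have key := WeakHelmholtz.sine_coeff_eq hκ hh1 hh2 hA0 hU hw
    (fun y hy => by rw [hUu _ z1 _ hy, hu.left y hy])
    (fun y hy => by rw [hUu _ o1 _ hy, hu.right y hy])
    (fun x hx => by rw [hUu _ hx _ z2, hu.bottom x hx])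
  have hh1' : (h1 : ℂ) ≠ 0 := by exact_mod_cast hh1.ne'
  have top : ∀ n, (2 / h1 : ℂ) * ∫ x in (0 : ℝ)..h1, U (x, h2) * (sin (sineFreq h1 n * x) : ℝ)
      = traceCoeff h1 h2 u n := fun n => by
    rw [traceCoeff]
    congr 1
    apply intervalIntegral.integral_congr
    intro x hx
    rw [uIcc_of_le hh1.le] at hx
    simp only [hUu x hx h2 o2, traceTop]
  rintro ⟨x, y⟩ ⟨hx, hy⟩
  have hy' := Ioo_subset_Icc_self hy
  have hx' := Ioo_subset_Icc_self hx
  have e : ∀ n, ∫ x in (0 : ℝ)..h1, U (x, y) * (sin (sineFreq h1 n * x) : ℝ)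
      = h1 / 2 * (traceCoeff h1 h2 u n * transFactor κ h1 h2 0 n y) := fun n => by
    rw [key n y hy', ← top]; field_simp
  have cN : Summable fun n => traceCoeff h1 h2 u n * transFactor κ h1 h2 0 n y := by
    obtain ⟨m, hm, hle⟩ := exists_summable_norm_transFactor_le hκ hh1 hh2 hA0 0 0 hy.2
    refine Summable.of_norm_bounded (hm.mul_left C) fun n => ?_
    have h := hle n y ⟨hy.1.le, le_rfl⟩
    rw [pow_zero, one_mul] at h
    rw [norm_mul]
    exact mul_le_mul (hC n) h (norm_nonneg _) ((norm_nonneg _).trans (hC n))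
  have S := hasSum_sine_series hh1 (f := fun x => U (x, y)) (hU.comp (by fun_prop))
    (by simp only [hUu _ z1 _ hy', hu.left y hy']) (by simp only [hUu _ o1 _ hy', hu.right y hy'])
    (by simp only [e]; exact cN.mul_left _) x hx'
  simp only [e, hUu _ hx' _ hy'] at S
  rw [← S.tsum_eq, modeSeries]
  congr 1; funext n
  have t : tanFactor h1 0 n x = sin (sineFreq h1 n * x) := by simp [tanFactor]
  simp only [t]
  field_simp

lemma continuous_tanFactor (h1 : ℝ) (i n : ℕ) : Continuous (tanFactor h1 i n) := by
  unfold tanFactor; fun_prop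

lemma continuous_transFactor (κ h1 h2 : ℝ) (j n : ℕ) : Continuous (transFactor κ h1 h2 j n) :=
  continuous_iff_continuousAt.2 fun y => (hasDerivAt_transFactor κ h1 h2 j n y).continuousAt

lemma integral_tanFactor_mul_tanFactor {h1 : ℝ} (hh1 : 0 < h1) (i : ℕ) {n m : ℕ} (h : n ≠ m) :
    ∫ x in (0 : ℝ)..h1, tanFactor h1 i n x * tanFactor h1 i m x = 0 := by
  have := integral_sin_mul_sin hh1 i (n := n) (m := m) (by omega)
  rw [if_neg h] at this
  have e : ∀ x, tanFactor h1 i n x * tanFactor h1 i m x =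
      (sineFreq h1 n ^ i * sineFreq h1 m ^ i) *
      (sin (sineFreq h1 n * x + i * (π / 2)) * sin (sineFreq h1 m * x + i * (π / 2))) :=
    fun x => by rw [tanFactor, tanFactor]; ring
  simp only [e]
  rw [intervalIntegral.integral_const_mul, this, mul_zero]

lemma integral_norm_sq_sum_tanFactor_le {h1 : ℝ} (hh1 : 0 < h1) (i : ℕ) (d : ℕ → ℂ) (L : ℕ) :
    ∫ x in (0 : ℝ)..h1, ‖∑ n ∈ Finset.range L, d n * (tanFactor h1 i n x : ℂ)‖ ^ 2
      ≤ h1 * ∑ n ∈ Finset.range L, ‖d n‖ ^ 2 * sineFreq h1 n ^ (2 * i) := by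
  have ct := continuous_tanFactor h1 i
  have e : ∀ x, ‖∑ n ∈ Finset.range L, d n * (tanFactor h1 i n x : ℂ)‖ ^ 2 =
      ∑ n ∈ Finset.range L, ∑ m ∈ Finset.range L, (d n * (starRingEnd ℂ) (d m)).re *
        (tanFactor h1 i n x * tanFactor h1 i m x) := fun x => by
    rw [← Complex.ofReal_re (‖_‖ ^ 2), Complex.ofReal_pow, ← Complex.mul_conj', map_sum,
      Finset.sum_mul_sum, Complex.re_sum]
    refine Finset.sum_congr rfl fun n _ => ?_
    rw [Complex.re_sum]
    refine Finset.sum_congr rfl fun m _ => ?_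
    rw [map_mul, Complex.conj_ofReal, ← Complex.re_mul_ofReal]
    congr 1; push_cast; ring
  simp only [e]
  have cc : ∀ n m, Continuous fun x => (d n * (starRingEnd ℂ) (d m)).re *
      (tanFactor h1 i n x * tanFactor h1 i m x) := fun n m =>
    continuous_const.mul ((ct n).mul (ct m))
  rw [intervalIntegral.integral_finsetSum fun n _ =>
    (continuous_finsetSum _ fun m _ => cc n m).intervalIntegrable _ _, Finset.mul_sum]
  refine Finset.sum_le_sum fun n hn => ?_
  rw [intervalIntegral.integral_finsetSum fun m _ => (cc n m).intervalIntegrable _ _,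
    Finset.sum_eq_single_of_mem n hn fun m _ hm => by
      rw [intervalIntegral.integral_const_mul, integral_tanFactor_mul_tanFactor hh1 i hm.symm,
        mul_zero], intervalIntegral.integral_const_mul, Complex.mul_conj, Complex.ofReal_re,
    Complex.normSq_eq_norm_sq]
  have b : ∫ x in (0 : ℝ)..h1, tanFactor h1 i n x * tanFactor h1 i n x
      ≤ ∫ x in (0 : ℝ)..h1, sineFreq h1 n ^ (2 * i) := by
    have c2 : Continuous fun x => tanFactor h1 i n x * tanFactor h1 i n x := (ct n).mul (ct n)
    refine intervalIntegral.integral_mono_on hh1.le (c2.intervalIntegrable _ _) (by simp)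
      fun x _ => ?_
    rw [← abs_mul_abs_self, mul_comm 2 i, pow_mul, pow_two]
    have := abs_tanFactor_le hh1 i n x
    exact mul_le_mul this this (abs_nonneg _) ((abs_nonneg _).trans this)
  rw [intervalIntegral.integral_const, smul_eq_mul, sub_zero] at b
  calc _ ≤ ‖d n‖ ^ 2 * (h1 * sineFreq h1 n ^ (2 * i)) := by gcongr
    _ = _ := by ring

lemma integral_norm_sq_slice_le {κ h1 : ℝ} (hh1 : 0 < h1) {B : ℝ} {j : ℕ} {q : ℕ → ℂ}
    (hq : ∀ n, ‖q n‖ ≤ B * ‖transFreq κ h1 n‖ ^ j) (b : ℕ → ℂ) (i L : ℕ) :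
    ∫ x in (0 : ℝ)..h1, ‖∑ n ∈ Finset.range L, b n * ((tanFactor h1 i n x : ℂ) * q n)‖ ^ 2
      ≤ h1 * (B ^ 2 * ∑ n ∈ Finset.range L,
        ‖b n‖ ^ 2 * (sineFreq h1 n ^ (2 * i) * ‖transFreq κ h1 n‖ ^ (2 * j))) := by
  have e : ∀ x, ∑ n ∈ Finset.range L, b n * ((tanFactor h1 i n x : ℂ) * q n) =
      ∑ n ∈ Finset.range L, (b n * q n) * (tanFactor h1 i n x : ℂ) := fun x =>
    Finset.sum_congr rfl fun n _ => by ring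
  simp only [e]
  refine (integral_norm_sq_sum_tanFactor_le hh1 i (fun n => b n * q n) L).trans ?_
  refine mul_le_mul_of_nonneg_left ?_ hh1.le
  rw [Finset.mul_sum]
  refine Finset.sum_le_sum fun n _ => ?_
  have hω := pow_nonneg (sineFreq_nonneg hh1 n) (2 * i)
  have h2 : ‖q n‖ ^ 2 ≤ (B * ‖transFreq κ h1 n‖ ^ j) ^ 2 :=
    pow_le_pow_left₀ (norm_nonneg _) (hq n) 2
  rw [norm_mul, mul_pow]
  calc _ ≤ ‖b n‖ ^ 2 * (B * ‖transFreq κ h1 n‖ ^ j) ^ 2 * sineFreq h1 n ^ (2 * i) := by gcongr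
    _ = _ := by ring

lemma integral_norm_sq_partial_le {κ h1 h2 : ℝ} (hh1 : 0 < h1)
    (hh2 : 0 < h2) {B : ℝ} {j : ℕ}
    (hB : ∀ n, ∀ y ∈ Icc 0 h2, ‖transFactor κ h1 h2 j n y‖ ≤ B * ‖transFreq κ h1 n‖ ^ j)
    (b : ℕ → ℂ) (i L : ℕ) :
    ∫ p in Khat h1 h2, ‖∑ n ∈ Finset.range L,
        b n * ((tanFactor h1 i n p.1 : ℂ) * transFactor κ h1 h2 j n p.2)‖ ^ 2
      ≤ h1 * h2 * B ^ 2 * ∑ n ∈ Finset.range L,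
        ‖b n‖ ^ 2 * (sineFreq h1 n ^ (2 * i) * ‖transFreq κ h1 n‖ ^ (2 * j)) := by
  have ct := continuous_tanFactor h1 i
  have cq := continuous_transFactor κ h1 h2 j
  obtain ⟨G, hG⟩ : ∃ G : ℝ × ℝ → ℝ, G = fun p => ‖∑ n ∈ Finset.range L,
      b n * ((tanFactor h1 i n p.1 : ℂ) * transFactor κ h1 h2 j n p.2)‖ ^ 2 := ⟨_, rfl⟩
  have cG : Continuous G := by
    rw [hG]
    exact ((continuous_finsetSum _ fun n _ => continuous_const.mul
      ((Complex.continuous_ofReal.comp ((ct n).comp continuous_fst)).mul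
      ((cq n).comp continuous_snd))).norm).pow 2
  obtain ⟨S, hS⟩ : ∃ S, S = ∑ n ∈ Finset.range L,
        ‖b n‖ ^ 2 * (sineFreq h1 n ^ (2 * i) * ‖transFreq κ h1 n‖ ^ (2 * j)) := ⟨_, rfl⟩
  have inner : ∀ y ∈ Icc 0 h2, ∫ x in (0 : ℝ)..h1, G (x, y) ≤ h1 * (B ^ 2 * S) := by
    intro y hy
    rw [hG, hS]
    exact integral_norm_sq_slice_le hh1 (fun n => hB n y hy) b i L
  rw [← hG, ← hS, integral_Khat hh1.le hh2.le cG, integral_swap_of_continuous hh1.le hh2.le cG]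
  have cI : Continuous fun y => ∫ x in (0 : ℝ)..h1, G (x, y) :=
    intervalIntegral.continuous_parametric_intervalIntegral_of_continuous'
      (f := fun y x => G (x, y)) (cG.comp continuous_swap) 0 h1
  have r := intervalIntegral.integral_mono_on hh2.le (cI.intervalIntegrable (μ := volume) _ _)
    (intervalIntegrable_const (c := h1 * (B ^ 2 * S))) inner
  refine r.trans (le_of_eq ?_)
  rw [intervalIntegral.integral_const, smul_eq_mul]; ring

/-- Square integrability of a mode expansion, with the corresponding bound. -/
lemma integrableOn_norm_sq_modeSeries {κ h1 h2 : ℝ} (hκ : 0 < κ) (hh1 : 0 < h1)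
    (hh2 : 0 < h2) (hA0 : A0cond κ h1 h2) {B : ℝ} {j : ℕ}
    (hB : ∀ n, ∀ y ∈ Icc 0 h2, ‖transFactor κ h1 h2 j n y‖ ≤ B * ‖transFreq κ h1 n‖ ^ j)
    {b : ℕ → ℂ} {C : ℝ} (hb : ∀ n, ‖b n‖ ≤ C) {i : ℕ}
    (hs : Summable fun n => ‖b n‖ ^ 2 * (sineFreq h1 n ^ (2 * i) * ‖transFreq κ h1 n‖ ^ (2 * j))) :
    AEStronglyMeasurable (modeSeries κ h1 h2 b i j) (volume.restrict (Khat h1 h2)) ∧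
    IntegrableOn (fun p => ‖modeSeries κ h1 h2 b i j p‖ ^ 2) (Khat h1 h2) ∧
    ∫ p in Khat h1 h2, ‖modeSeries κ h1 h2 b i j p‖ ^ 2 ≤ h1 * h2 * B ^ 2 *
      ∑' n, ‖b n‖ ^ 2 * (sineFreq h1 n ^ (2 * i) * ‖transFreq κ h1 n‖ ^ (2 * j)) := by
  have ct := continuous_tanFactor h1 i
  have cq := continuous_transFactor κ h1 h2 j
  have mK : MeasurableSet (Khat h1 h2) := measurableSet_Ioo.prod measurableSet_Ioo
  set w : ℕ → ℝ := fun n =>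
    ‖b n‖ ^ 2 * (sineFreq h1 n ^ (2 * i) * ‖transFreq κ h1 n‖ ^ (2 * j)) with hw
  have w0 : ∀ n, 0 ≤ w n := fun n => by
    have := sineFreq_nonneg hh1 n
    simp only [hw]; positivity
  set F : ℕ → ℝ × ℝ → ℂ := fun L p => ∑ n ∈ Finset.range L,
      b n * ((tanFactor h1 i n p.1 : ℂ) * transFactor κ h1 h2 j n p.2) with hF
  have cF : ∀ L, Continuous (F L) := fun L =>
    continuous_finsetSum _ fun n _ => continuous_const.mul
      ((Complex.continuous_ofReal.comp ((ct n).comp continuous_fst)).mul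
      ((cq n).comp continuous_snd))
  have lim : ∀ p ∈ Khat h1 h2, Filter.Tendsto (fun L => F L p) Filter.atTop
      (nhds (modeSeries κ h1 h2 b i j p)) := fun p hp =>
    (summable_modeSeries hκ hh1 hh2 hA0 hb i j p.1 hp.2).hasSum.tendsto_sum_nat
  have meas : AEStronglyMeasurable (modeSeries κ h1 h2 b i j) (volume.restrict (Khat h1 h2)) :=
    aestronglyMeasurable_of_tendsto_ae Filter.atTop (fun L => (cF L).aestronglyMeasurable)
      ((ae_restrict_iff' mK).2 (Filter.Eventually.of_forall lim))
  set T := h1 * h2 * B ^ 2 * ∑' n, w n with hT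
  have T0 : 0 ≤ T := mul_nonneg (by positivity) (tsum_nonneg w0)
  have bound : ∫⁻ p in Khat h1 h2, ENNReal.ofReal (‖modeSeries κ h1 h2 b i j p‖ ^ 2)
      ≤ ENNReal.ofReal T := by
    have e : ∫⁻ p in Khat h1 h2, ENNReal.ofReal (‖modeSeries κ h1 h2 b i j p‖ ^ 2) =
        ∫⁻ p in Khat h1 h2, Filter.liminf (fun L => ENNReal.ofReal (‖F L p‖ ^ 2)) Filter.atTop :=
      setLIntegral_congr_fun mK fun p hp => by
        symm
        exact ((ENNReal.continuous_ofReal.tendsto _).comp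
          (((lim p hp).norm).pow 2)).liminf_eq
    rw [e]
    refine (lintegral_liminf_le fun L => ((cF L).norm.pow 2).measurable.ennreal_ofReal).trans ?_
    refine Filter.liminf_le_of_frequently_le' (Filter.Frequently.of_forall fun L => ?_)
    rw [← ofReal_integral_eq_lintegral_ofReal
      (integrableOn_Khat ((cF L).norm.pow 2).continuousOn)
      (Filter.Eventually.of_forall fun p => sq_nonneg _)]
    apply ENNReal.ofReal_le_ofReal
    refine (integral_norm_sq_partial_le hh1 hh2 hB b i L).trans ?_
    exact mul_le_mul_of_nonneg_left (hs.sum_le_tsum _ fun n _ => w0 n) (by positivity)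
  have m2 : AEStronglyMeasurable (fun p => ‖modeSeries κ h1 h2 b i j p‖ ^ 2)
    (volume.restrict (Khat h1 h2)) := meas.norm.pow 2
  refine ⟨meas, ⟨m2, ?_⟩, ?_⟩
  · rw [hasFiniteIntegral_iff_ofReal (Filter.Eventually.of_forall fun p => sq_nonneg _)]
    exact bound.trans_lt ENNReal.ofReal_lt_top
  · rw [integral_eq_lintegral_of_nonneg_ae (Filter.Eventually.of_forall fun p => sq_nonneg _) m2]
    exact ENNReal.toReal_le_of_le_ofReal T0 bound

/-- A mode expansion is orthogonal to every mode that it does not contain. -/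
lemma integral_modeSeries_mul_conj_eq_zero {κ h1 h2 : ℝ} (hκ : 0 < κ) (hh1 : 0 < h1)
    (hh2 : 0 < h2) (hA0 : A0cond κ h1 h2) {b : ℕ → ℂ} {C : ℝ} (hb : ∀ n, ‖b n‖ ≤ C) {i j : ℕ}
    (meas : AEStronglyMeasurable (modeSeries κ h1 h2 b i j) (volume.restrict (Khat h1 h2)))
    (hbint : IntegrableOn (fun p => ‖modeSeries κ h1 h2 b i j p‖ ^ 2) (Khat h1 h2))
    {m : ℕ} (hm : b m = 0) :
    IntegrableOn (fun p => modeSeries κ h1 h2 b i j p *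
      (starRingEnd ℂ) ((tanFactor h1 i m p.1 : ℂ) * transFactor κ h1 h2 j m p.2)) (Khat h1 h2) ∧
    ∫ p in Khat h1 h2, modeSeries κ h1 h2 b i j p *
      (starRingEnd ℂ) ((tanFactor h1 i m p.1 : ℂ) * transFactor κ h1 h2 j m p.2) = 0 := by
  have ct := continuous_tanFactor h1 i
  have cq := continuous_transFactor κ h1 h2 j
  set φ : ℝ × ℝ → ℂ := fun p =>
    (starRingEnd ℂ) ((tanFactor h1 i m p.1 : ℂ) * transFactor κ h1 h2 j m p.2) with hφ
  have cφ : Continuous φ := Complex.continuous_conj.comp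
      ((Complex.continuous_ofReal.comp ((ct m).comp continuous_fst)).mul
      ((cq m).comp continuous_snd))
  have int : IntegrableOn (fun p => modeSeries κ h1 h2 b i j p * φ p) (Khat h1 h2) := by
    have i2 : IntegrableOn (fun p => ‖φ p‖ ^ 2) (Khat h1 h2) :=
      integrableOn_Khat (cφ.norm.pow 2).continuousOn
    refine (hbint.add i2).mono' (meas.mul cφ.aestronglyMeasurable)
      (Filter.Eventually.of_forall fun p => ?_)
    simp only [norm_mul, Pi.add_apply]
    nlinarith [sq_nonneg (‖modeSeries κ h1 h2 b i j p‖ - ‖φ p‖),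
      sq_nonneg (‖modeSeries κ h1 h2 b i j p‖), sq_nonneg ‖φ p‖]
  refine ⟨int, ?_⟩
  have int' := int
  unfold Khat IntegrableOn at int'
  unfold Khat
  rw [Measure.volume_eq_prod, ← Measure.prod_restrict] at int' ⊢
  rw [integral_prod_symm _ int', ← integral_zero ℝ ℂ]
  refine setIntegral_congr_fun measurableSet_Ioo fun y hy => ?_
  change ∫ x in Ioo 0 h1, modeSeries κ h1 h2 b i j (x, y) * φ (x, y) = 0
  rw [← integral_Ioc_eq_integral_Ioo, ← intervalIntegral.integral_of_le hh1.le]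
  obtain ⟨μ, hμ, hle⟩ := exists_summable_norm_coeff_mul_mode_le hκ hh1 hh2 hA0 hb i j hy.2
  have hs := intervalIntegral.hasSum_integral_of_dominated_convergence (μ := volume)
    (a := 0) (b := h1) (F := fun n x => b n * ((tanFactor h1 i n x : ℂ) *
      transFactor κ h1 h2 j n y) * φ (x, y))
    (f := fun x => modeSeries κ h1 h2 b i j (x, y) * φ (x, y))
    (fun n x => μ n * ‖φ (x, y)‖) (fun n => ?_) (fun n => ?_) ?_ ?_ ?_
  · refine hs.unique ?_
    convert hasSum_zero with n
    have : ∀ x, b n * ((tanFactor h1 i n x : ℂ) * transFactor κ h1 h2 j n y) * φ (x, y)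
        = (b n * transFactor κ h1 h2 j n y * (starRingEnd ℂ) (transFactor κ h1 h2 j m y)) *
          ((tanFactor h1 i n x * tanFactor h1 i m x : ℝ) : ℂ) := fun x => by
      simp only [hφ, map_mul, Complex.conj_ofReal]; push_cast; ring
    simp only [this]
    rw [intervalIntegral.integral_const_mul, intervalIntegral.integral_ofReal]
    rcases eq_or_ne n m with rfl | hnm
    · rw [hm]; simp
    · rw [integral_tanFactor_mul_tanFactor hh1 i hnm]; simp
  · have cF : Continuous fun x => b n * ((tanFactor h1 i n x : ℂ) *
      transFactor κ h1 h2 j n y) * φ (x, y) :=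
      (continuous_const.mul ((Complex.continuous_ofReal.comp (ct n)).mul
        continuous_const)).mul (cφ.comp (by fun_prop))
    exact cF.aestronglyMeasurable
  · refine Filter.Eventually.of_forall fun x _ => ?_
    rw [norm_mul]
    exact mul_le_mul_of_nonneg_right (hle n x y ⟨hy.1.le, le_rfl⟩) (norm_nonneg _)
  · exact Filter.Eventually.of_forall fun x _ => hμ.mul_right _
  · simp only [tsum_mul_right]
    exact (continuous_const.mul (cφ.comp (by fun_prop : Continuous fun x : ℝ => (x, y))).norm).intervalIntegrable _ _
  · refine Filter.Eventually.of_forall fun x _ => ?_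
    exact (summable_modeSeries hκ hh1 hh2 hA0 hb i j x hy).hasSum.mul_right _

lemma SLoc.summable_weighted_traceCoeff {κ h1 h2 : ℝ} (hκ : 0 < κ) (hh1 : 0 < h1) {N M : ℕ}
    {u : ℝ × ℝ → ℂ} (hu : SLoc κ h1 h2 N M u) {i j : ℕ} (hij : i + j ≤ min (2 * N) M) :
    Summable fun n => ‖traceCoeff h1 h2 u n‖ ^ 2 *
      (sineFreq h1 n ^ (2 * i) * ‖transFreq κ h1 n‖ ^ (2 * j)) := by
  have S := (hu.summable_traceCoeff hh1 (hij.trans (min_le_left _ _))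
    (hij.trans (min_le_right _ _))).mul_left ((κ * h1 / π + 1) ^ (2 * j))
  refine Summable.of_nonneg_of_le (fun n => ?_) (fun n => ?_) S
  · have := sineFreq_nonneg hh1 n
    positivity
  · rcases Nat.eq_zero_or_pos n with rfl | hn
    · simp [traceCoeff_zero]
    have h0 := sineFreq_nonneg hh1 n
    have hz : ‖transFreq κ h1 n‖ ≤ (κ * h1 / π + 1) * sineFreq h1 n := by
      refine (norm_transFreq_le hκ hh1 n).trans ?_
      have e : κ * h1 / π * sineFreq h1 n = κ * n := by
        rw [sineFreq]; field_simp
      have : (1 : ℝ) ≤ n := by exact_mod_cast hn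
      rw [add_mul, e]
      nlinarith
    calc ‖traceCoeff h1 h2 u n‖ ^ 2 * (sineFreq h1 n ^ (2 * i) * ‖transFreq κ h1 n‖ ^ (2 * j))
        ≤ ‖traceCoeff h1 h2 u n‖ ^ 2 * (sineFreq h1 n ^ (2 * i) *
          ((κ * h1 / π + 1) * sineFreq h1 n) ^ (2 * j)) := by gcongr
      _ = _ := by rw [mul_add 2 i j, pow_add, mul_pow]; ring

/-- Splitting off finitely many modes from a mode expansion. -/
lemma modeSeries_eq_sum_add {κ h1 h2 : ℝ} (hκ : 0 < κ) (hh1 : 0 < h1)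
    (hh2 : 0 < h2) (hA0 : A0cond κ h1 h2) {a : ℕ → ℂ} {C : ℝ} (ha : ∀ n, ‖a n‖ ≤ C) (i j : ℕ)
    (s : Finset ℕ) {p : ℝ × ℝ} (hp : p ∈ Khat h1 h2) :
    modeSeries κ h1 h2 a i j p =
      ∑ n ∈ s, a n * ((tanFactor h1 i n p.1 : ℂ) * transFactor κ h1 h2 j n p.2) +
      modeSeries κ h1 h2 (fun n => if n ∈ s then 0 else a n) i j p := by
  have S := summable_modeSeries hκ hh1 hh2 hA0 ha i j p.1 hp.2
  have F := hasSum_sum_of_ne_finset_zero (L := .unconditional ℕ) (s := s)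
    (f := fun n => if n ∈ s then
      a n * ((tanFactor h1 i n p.1 : ℂ) * transFactor κ h1 h2 j n p.2) else 0)
    fun n hn => if_neg hn
  rw [Finset.sum_congr rfl fun n hn => if_pos hn] at F
  have T := (S.hasSum.sub F).tsum_eq
  rw [modeSeries, modeSeries, ← sub_eq_iff_eq_add', ← T]
  congr 1; funext n
  split_ifs <;> simp

lemma norm_ite_le {a : ℕ → ℂ} {C : ℝ} (ha : ∀ n, ‖a n‖ ≤ C) (s : Finset ℕ) (n : ℕ) :
    ‖if n ∈ s then 0 else a n‖ ≤ C := by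
  split_ifs
  · simpa using (norm_nonneg _).trans (ha n)
  · exact ha n

lemma summable_weighted_ite {a : ℕ → ℂ} {w : ℕ → ℝ} (hw : ∀ n, 0 ≤ w n)
    (hs : Summable fun n => ‖a n‖ ^ 2 * w n) (s : Finset ℕ) :
    Summable fun n => ‖if n ∈ s then 0 else a n‖ ^ 2 * w n := by
  refine Summable.of_nonneg_of_le (fun n => mul_nonneg (sq_nonneg _) (hw n)) (fun n => ?_) hs
  split_ifs
  · simpa using mul_nonneg (sq_nonneg ‖a n‖) (hw n)
  · rfl

lemma tendsto_tsum_weighted_ite {a : ℕ → ℂ} {w : ℕ → ℝ} (hw : ∀ n, 0 ≤ w n)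
    (hs : Summable fun n => ‖a n‖ ^ 2 * w n) :
    Filter.Tendsto (fun K => ∑' n, ‖if n ∈ Finset.range K then 0 else a n‖ ^ 2 * w n)
      Filter.atTop (nhds 0) := by
  have := tendsto_tsum_of_dominated_convergence (𝓕 := Filter.atTop)
    (f := fun K n => ‖if n ∈ Finset.range K then 0 else a n‖ ^ 2 * w n) (g := fun _ => (0 : ℝ)) hs
    (fun n => tendsto_const_nhds.congr' ?_) (Filter.Eventually.of_forall fun K n => ?_)
  · simpa using this
  · filter_upwards [Filter.eventually_gt_atTop n] with K hK
    simp [hK]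
  · split_ifs
    · simpa using mul_nonneg (sq_nonneg ‖a n‖) (hw n)
    · rw [Real.norm_of_nonneg (mul_nonneg (sq_nonneg _) (hw n))]

lemma sum_le_of_mem_idxLe {m : ℕ} {p : ℕ × ℕ} (hp : p ∈ idxLe m) : p.1 + p.2 ≤ m :=
  (Finset.mem_filter.1 hp).2

lemma exists_norm_transFactor_le_pow {κ h1 h2 : ℝ} (hκ : 0 < κ) (hh1 : 0 < h1) (hh2 : 0 < h2)
    (hA0 : A0cond κ h1 h2) : ∃ B : ℝ, ∀ (j n : ℕ), ∀ y ∈ Icc 0 h2,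
      ‖transFactor κ h1 h2 j n y‖ ≤ B * ‖transFreq κ h1 n‖ ^ j := by
  obtain ⟨B, hB0, hB⟩ := exists_norm_transFactor_le hκ hh1 hh2 hA0
  refine ⟨B, fun j n y hy => (hB j n y hy).trans (mul_le_of_le_one_right (by positivity) ?_)⟩
  rw [exp_le_one_iff]
  have := mul_nonneg (abs_nonneg (transFreq κ h1 n).im) (sub_nonneg.2 hy.2)
  linarith

/-- The partial sums of the mode expansion converge in the Sobolev norm. -/
lemma SLoc.tendsto_sobNormSq {κ h1 h2 : ℝ} (hκ : 0 < κ) (hh1 : 0 < h1) (hh2 : 0 < h2)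
    (hA0 : A0cond κ h1 h2) {N M : ℕ} {u : ℝ × ℝ → ℂ} (hu : SLoc κ h1 h2 N M u) {m : ℕ}
    (hm : m ≤ min (2 * N) M) :
    Filter.Tendsto (fun K => sobNormSq κ m (Khat h1 h2)
      (u - ∑ n ∈ Finset.range K, traceCoeff h1 h2 u n • phiHat κ h1 h2 n))
      Filter.atTop (nhds 0) := by
  obtain ⟨C, hC⟩ := hu.exists_norm_traceCoeff_le hh1
  obtain ⟨B, hB⟩ := exists_norm_transFactor_le_pow hκ hh1 hh2 hA0
  have mK : MeasurableSet (Khat h1 h2) := measurableSet_Ioo.prod measurableSet_Ioo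
  unfold sobNormSq
  rw [← Finset.sum_const_zero (s := idxLe m)]
  refine tendsto_finsetSum _ fun p hp => ?_
  have hij := (sum_le_of_mem_idxLe hp).trans hm
  set w : ℕ → ℝ := fun n => sineFreq h1 n ^ (2 * p.1) * ‖transFreq κ h1 n‖ ^ (2 * p.2) with hw
  have w0 : ∀ n, 0 ≤ w n := fun n => by
    have := sineFreq_nonneg hh1 n
    simp only [hw]; positivity
  have hs := hu.summable_weighted_traceCoeff hκ hh1 hij
  have T := (tendsto_tsum_weighted_ite w0 hs).const_mul (h1 * h2 * B ^ 2)
  rw [mul_zero] at T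
  rw [← mul_zero ((κ ^ (2 * (p.1 + p.2)))⁻¹)]
  refine Filter.Tendsto.const_mul _ (squeeze_zero
    (fun K => integral_nonneg fun x => sq_nonneg _) (fun K => ?_) T)
  have eq0 : EqOn (u - ∑ n ∈ Finset.range K, traceCoeff h1 h2 u n • phiHat κ h1 h2 n)
      (modeSeries κ h1 h2 (fun n => if n ∈ Finset.range K then 0 else traceCoeff h1 h2 u n) 0 0)
      (Khat h1 h2) := fun q hq => by
    rw [Pi.sub_apply, hu.eqOn_modeSeries hκ hh1 hh2 hA0 hq,
      modeSeries_eq_sum_add hκ hh1 hh2 hA0 hC 0 0 (Finset.range K) hq, Finset.sum_apply]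
    simp only [phiHat_eq hκ, Pi.smul_apply, smul_eq_mul]
    ring
  have eq := eqOn_pdM_modeSeries hκ hh1 hh2 hA0 (norm_ite_le hC (Finset.range K)) eq0 p.1 p.2
  rw [setIntegral_congr_fun (g := fun q => ‖modeSeries κ h1 h2
    (fun n => if n ∈ Finset.range K then 0 else traceCoeff h1 h2 u n) p.1 p.2 q‖ ^ 2) mK
    fun q hq => by simp only [eq hq]]
  exact (integrableOn_norm_sq_modeSeries hκ hh1 hh2 hA0 (hB p.2) (norm_ite_le hC (Finset.range K))
    (summable_weighted_ite w0 hs (Finset.range K))).2.2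

/-- The Sobolev coefficients are determined by the sine coefficients of the trace. -/
lemma SLoc.sobInner_phiHat {κ h1 h2 : ℝ} (hκ : 0 < κ) (hh1 : 0 < h1) (hh2 : 0 < h2)
    (hA0 : A0cond κ h1 h2) {N M : ℕ} {u : ℝ × ℝ → ℂ} (hu : SLoc κ h1 h2 N M u) {m : ℕ}
    (hm : m ≤ min (2 * N) M) (n : ℕ) :
    sobInner κ m (Khat h1 h2) u (phiHat κ h1 h2 n) =
      traceCoeff h1 h2 u n * sobNormSq κ m (Khat h1 h2) (phiHat κ h1 h2 n) := by
  obtain ⟨C, hC⟩ := hu.exists_norm_traceCoeff_le hh1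
  obtain ⟨B, hB⟩ := exists_norm_transFactor_le_pow hκ hh1 hh2 hA0
  have mK : MeasurableSet (Khat h1 h2) := measurableSet_Ioo.prod measurableSet_Ioo
  unfold sobInner sobNormSq
  rw [Complex.ofReal_sum, Finset.mul_sum]
  refine Finset.sum_congr rfl fun p hp => ?_
  have hij := (sum_le_of_mem_idxLe hp).trans hm
  set w : ℕ → ℝ := fun n => sineFreq h1 n ^ (2 * p.1) * ‖transFreq κ h1 n‖ ^ (2 * p.2) with hw
  have w0 : ∀ n, 0 ≤ w n := fun n => by
    have := sineFreq_nonneg hh1 n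
    simp only [hw]; positivity
  have hs := hu.summable_weighted_traceCoeff hκ hh1 hij
  have L := integrableOn_norm_sq_modeSeries hκ hh1 hh2 hA0 (hB p.2) (norm_ite_le hC {n})
    (summable_weighted_ite w0 hs {n})
  have O := integral_modeSeries_mul_conj_eq_zero hκ hh1 hh2 hA0 (norm_ite_le hC {n}) L.1 L.2.1
    (m := n) (by simp)
  have eq := eqOn_pdM_modeSeries hκ hh1 hh2 hA0 hC (hu.eqOn_modeSeries hκ hh1 hh2 hA0) p.1 p.2
  simp only [pdM_phiHat hκ]
  set φ : ℝ × ℝ → ℂ := fun q => (tanFactor h1 p.1 n q.1 : ℂ) * transFactor κ h1 h2 p.2 n q.2 with hφ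
  have cφ : Continuous φ := (Complex.continuous_ofReal.comp
    ((continuous_tanFactor h1 p.1 n).comp continuous_fst)).mul
      ((continuous_transFactor κ h1 h2 p.2 n).comp continuous_snd)
  have key : ∫ q in Khat h1 h2, pdM p.1 p.2 u q * (starRingEnd ℂ) (φ q)
      = traceCoeff h1 h2 u n * ((∫ q in Khat h1 h2, ‖φ q‖ ^ 2 : ℝ) : ℂ) := by
    rw [setIntegral_congr_fun (g := fun q => traceCoeff h1 h2 u n * ((‖φ q‖ ^ 2 : ℝ) : ℂ) +
      modeSeries κ h1 h2 (fun k => if k ∈ ({n} : Finset ℕ) then 0 else traceCoeff h1 h2 u k)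
        p.1 p.2 q * (starRingEnd ℂ) (φ q)) mK fun q hq => ?_]
    · have i1 : IntegrableOn (fun q => traceCoeff h1 h2 u n * ((‖φ q‖ ^ 2 : ℝ) : ℂ))
          (Khat h1 h2) := integrableOn_Khat (continuous_const.mul
            (Complex.continuous_ofReal.comp (cφ.norm.pow 2))).continuousOn
      rw [integral_add i1 O.1, O.2, add_zero, integral_const_mul, integral_complex_ofReal]
    · simp only [eq hq]
      rw [modeSeries_eq_sum_add hκ hh1 hh2 hA0 hC p.1 p.2 {n} hq, Finset.sum_singleton,
        Complex.ofReal_pow, ← Complex.mul_conj']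
      ring
  rw [key]
  push_cast
  ring

lemma phiHat_top {κ h1 h2 : ℝ} (hκ : 0 < κ) (hh1 : 0 < h1)
    (hh2 : 0 < h2) (hA0 : A0cond κ h1 h2) (n : ℕ) (t : ℝ) :
    phiHat κ h1 h2 n (t, h2) = (sin (sineFreq h1 n * t) : ℝ) := by
  rw [phiHat_eq hκ]
  simp only [transFactor_top hκ hh1 hh2 hA0, tanFactor]
  simp

lemma traceL2Sq_phiHat {κ h1 h2 : ℝ} (hκ : 0 < κ) (hh1 : 0 < h1)
    (hh2 : 0 < h2) (hA0 : A0cond κ h1 h2) {n : ℕ} (hn : 1 ≤ n) :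
    traceL2Sq h1 h2 (phiHat κ h1 h2 n) = h1 / 2 := by
  have := integral_sin_mul_sin hh1 0 (n := n) (m := n) (by omega)
  rw [if_pos rfl] at this
  rw [traceL2Sq, ← this]
  congr 1; funext t
  rw [phiHat_top hκ hh1 hh2 hA0, Complex.norm_real, Real.norm_eq_abs, sq_abs]
  simp [pow_two]

lemma traceL2Inner_phiHat {κ h1 h2 : ℝ} (hκ : 0 < κ) (hh1 : 0 < h1)
    (hh2 : 0 < h2) (hA0 : A0cond κ h1 h2) (u : ℝ × ℝ → ℂ) (n : ℕ) :
    traceL2Inner h1 h2 u (phiHat κ h1 h2 n) = h1 / 2 * traceCoeff h1 h2 u n := by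
  have hh1' : (h1 : ℂ) ≠ 0 := by exact_mod_cast hh1.ne'
  simp only [traceL2Inner, phiHat_top hκ hh1 hh2 hA0, Complex.conj_ofReal, traceCoeff, traceTop]
  field_simp

lemma sobNormSq_nonneg {κ : ℝ} (hκ : 0 < κ) (m : ℕ) (D : Set (ℝ × ℝ)) (f : ℝ × ℝ → ℂ) :
    0 ≤ sobNormSq κ m D f :=
  Finset.sum_nonneg fun p _ => mul_nonneg (by positivity) (integral_nonneg fun x => sq_nonneg _)

/-- Proposition 2.7, completeness: under Assumption A0, every member of
`S^{N,M}_κ(K̂,ŝ)` lies in the `H^μ_κ(K̂)`-closure of the span of the single-edge Helmholtz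
modes, and its expansion coefficients are determined by its trace on the top edge `ŝ`. -/
theorem single_edge_modes_complete (κ h1 h2 : ℝ) (hκ : 0 < κ) (hh1 : 0 < h1) (hh2 : 0 < h2)
    (hA0 : A0cond κ h1 h2) (N M : ℕ) (hN : 1 ≤ N) (hM : 1 ≤ M) (hNM : N ≤ (M + 1) / 2)
    (μ : ℕ) (hμ : μ ≤ min (2 * N) M)
    (u : ℝ × ℝ → ℂ) (hu : SLoc κ h1 h2 N M u) :
    (∀ ε > (0 : ℝ), ∃ v ∈ Submodule.span ℂ ((phiHat κ h1 h2) '' {k : ℕ | 1 ≤ k}),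
        sobNorm κ μ (Khat h1 h2) (u - v) < ε) ∧
    ∀ n : ℕ, 1 ≤ n →
      sobInner κ μ (Khat h1 h2) u (phiHat κ h1 h2 n) /
          (sobNorm κ μ (Khat h1 h2) (phiHat κ h1 h2 n) : ℂ) =
        ((sobNorm κ μ (Khat h1 h2) (phiHat κ h1 h2 n) /
            traceL2Sq h1 h2 (phiHat κ h1 h2 n) : ℝ) : ℂ) *
          traceL2Inner h1 h2 u (phiHat κ h1 h2 n) := by
  constructor
  · intro ε hε
    have T := (hu.tendsto_sobNormSq hκ hh1 hh2 hA0 hμ).sqrt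
    rw [Real.sqrt_zero] at T
    obtain ⟨K, hK⟩ := (T.eventually (gt_mem_nhds hε)).exists
    refine ⟨_, Submodule.sum_mem _ fun n _ => ?_, hK⟩
    rcases Nat.eq_zero_or_pos n with rfl | hn
    · rw [traceCoeff_zero, zero_smul]
      exact Submodule.zero_mem _
    · exact Submodule.smul_mem _ _ (Submodule.subset_span ⟨n, hn, rfl⟩)
  · intro n hn
    have hh1' : (h1 : ℂ) ≠ 0 := by exact_mod_cast hh1.ne'
    rw [hu.sobInner_phiHat hκ hh1 hh2 hA0 hμ n, traceL2Sq_phiHat hκ hh1 hh2 hA0 hn,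
      traceL2Inner_phiHat hκ hh1 hh2 hA0,
      ← Real.sq_sqrt (sobNormSq_nonneg hκ μ (Khat h1 h2) (phiHat κ h1 h2 n)), ← sobNorm]
    rcases eq_or_ne (sobNorm κ μ (Khat h1 h2) (phiHat κ h1 h2 n)) 0 with h | h
    · simp [h]
    · have h' : (sobNorm κ μ (Khat h1 h2) (phiHat κ h1 h2 n) : ℂ) ≠ 0 := by exact_mod_cast h
      push_cast
      field_simp

end
end
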